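/- arXiv:2605.21761 — 2 statements merged into one kernel-verified Lean document; each statement's English description precedes it below -/
import Mathlib

section
/- Let φ be a circle covering map of degree two of class C² with positive derivative, with φ(0)=0, φ′(0)=1 and φ″(0)=0. Suppose φ is not topologically conjugate to the doubling map, that the collection of all maximal periodic intervals of φ is finite and nonempty, say I₁,…,I_r, and set Λ := 𝕊¹ \ ⋃_{n≥0} φ^{-n}(I₁ ∪ ⋯ ∪ I_r). Then the action of T_φ satisfies property (Λ∗): for every x ∈ Λ such that g′(x) ≤ 1 for all g ∈ T_φ, (i) if (x, x+ε) ∩ Λ ≠ ∅ for every ε > 0 then there exists g₊ ∈ T_φ with g₊(x) = x, g₊′(x) = 1, and δ > 0 such that the lift ĝ₊ of g₊ fixing a lift x̃ of x satisfies ĝ₊(y) > y for all y ∈ (x̃, x̃+δ); and (ii) if (x−ε, x) ∩ Λ ≠ ∅ for every ε > 0 then there exists g₋ ∈ T_φ with g₋(x) = x, g₋′(x) = 1, and δ > 0 such that the lift ĝ₋ of g₋ fixing x̃ satisfies ĝ₋(y) < y for all y ∈ (x̃−δ, x̃). -/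
open Set Filter MeasureTheory Topology

noncomputable section

/-- `F : ℝ → ℝ` is a lift of `φ : 𝕊¹ → 𝕊¹` witnessing that `φ` is a
circle covering map of degree two. -/
def IsLiftDeg2 (φ : UnitAddCircle → UnitAddCircle) (F : ℝ → ℝ) : Prop :=
  Continuous F ∧ StrictMono F ∧ (∀ x : ℝ, F (x + 1) = F x + 2) ∧
    ∀ x : ℝ, φ (x : UnitAddCircle) = ((F x : ℝ) : UnitAddCircle)

/-- The closed arc on the circle starting at `a` (counterclockwise) of length `ℓ`. -/
def closedArc (a ℓ : ℝ) : Set UnitAddCircle :=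
  (fun t : ℝ => (t : UnitAddCircle)) '' Set.Icc a (a + ℓ)

/-- The open arc on the circle starting at `a` (counterclockwise) of length `ℓ`. -/
def openArc (a ℓ : ℝ) : Set UnitAddCircle :=
  (fun t : ℝ => (t : UnitAddCircle)) '' Set.Ioo a (a + ℓ)

/-- The open arc `(x, x + ε)` counterclockwise. -/
def rightArc (x : UnitAddCircle) (ε : ℝ) : Set UnitAddCircle :=
  {y | ∃ t : ℝ, 0 < t ∧ t < ε ∧ y = x + (t : UnitAddCircle)}

/-- The open arc `(x - ε, x)` counterclockwise. -/
def leftArc (x : UnitAddCircle) (ε : ℝ) : Set UnitAddCircle :=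
  {y | ∃ t : ℝ, 0 < t ∧ t < ε ∧ y = x - (t : UnitAddCircle)}

/-- `I` is a periodic interval of `φ` of period `s`: a proper nondegenerate closed arc
mapped onto itself homeomorphically by `φ^s`. -/
def IsPeriodicInterval (φ : UnitAddCircle → UnitAddCircle) (s : ℕ)
    (I : Set UnitAddCircle) : Prop :=
  1 ≤ s ∧ (∃ a ℓ : ℝ, 0 < ℓ ∧ ℓ < 1 ∧ I = closedArc a ℓ) ∧ Set.BijOn (φ^[s]) I I

/-- A maximal periodic interval of `φ`. -/
def IsMaxPeriodicInterval (φ : UnitAddCircle → UnitAddCircle)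
    (I : Set UnitAddCircle) : Prop :=
  (∃ s, IsPeriodicInterval φ s I) ∧ ∀ J, (∃ s, IsPeriodicInterval φ s J) → I ⊆ J → I = J

/-- `Λ = 𝕊¹ \ ⋃ₙ φ⁻ⁿ(I₁ ∪ ⋯ ∪ I_r)`, the complement of all preimages of the
maximal periodic intervals. -/
def lambdaSet (φ : UnitAddCircle → UnitAddCircle) : Set UnitAddCircle :=
  Set.univ \ ⋃ n : ℕ, (φ^[n]) ⁻¹' (⋃ I ∈ {I | IsMaxPeriodicInterval φ I}, I)

/-- The doubling map `x ↦ 2x (mod 1)`. -/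
def doubling : UnitAddCircle → UnitAddCircle := fun x => x + x

/-- `φ` is topologically conjugate to the doubling map. -/
def ConjugateToDoubling (φ : UnitAddCircle → UnitAddCircle) : Prop :=
  ∃ h : UnitAddCircle ≃ₜ UnitAddCircle, ∀ x, h (φ x) = doubling (h x)

/-- `I` is a `φ`-dyadic interval of degree `n` (described via the lift `F` of `φ`):
a closed arc whose endpoints are consecutive `φⁿ`-preimages of `0`. -/
def IsDyadic (F : ℝ → ℝ) (n : ℕ) (I : Set UnitAddCircle) : Prop :=
  ∃ a b : ℝ, a < b ∧ (∃ k : ℤ, F^[n] a = (k : ℝ)) ∧ F^[n] b = F^[n] a + 1 ∧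
    I = (fun t : ℝ => (t : UnitAddCircle)) '' Set.Icc a b

/-- `G` is a lift of the orientation-preserving circle homeomorphism `g`. -/
def IsOPLift (g : UnitAddCircle → UnitAddCircle) (G : ℝ → ℝ) : Prop :=
  Continuous G ∧ StrictMono G ∧ (∀ x : ℝ, G (x + 1) = G x + 1) ∧
    ∀ x : ℝ, g (x : UnitAddCircle) = ((G x : ℝ) : UnitAddCircle)

/-- `g` belongs to the Ghys–Sergiescu Thompson group `T_φ` (with `F` a lift of `φ`):
`g` is an orientation-preserving circle homeomorphism and there are partitions of the
circle into `φ`-dyadic intervals `I k`, `J k` such that `g` maps `I k` onto `J k` and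
`g = φ_{J k}⁻¹ ∘ φ_{I k}` on `I k`, i.e. `φ^[m k] ∘ g = φ^[n k]` on `I k`. -/
def InThompsonGroup (φ : UnitAddCircle → UnitAddCircle) (F : ℝ → ℝ)
    (g : UnitAddCircle → UnitAddCircle) : Prop :=
  (∃ G : ℝ → ℝ, IsOPLift g G) ∧
  ∃ (r : ℕ) (I J : Fin r → Set UnitAddCircle) (n m : Fin r → ℕ),
    0 < r ∧
    (∀ k, IsDyadic F (n k) (I k)) ∧ (∀ k, IsDyadic F (m k) (J k)) ∧
    (⋃ k, I k) = Set.univ ∧ (⋃ k, J k) = Set.univ ∧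
    (Pairwise fun k l => interior (I k) ∩ interior (I l) = ∅) ∧
    (Pairwise fun k l => interior (J k) ∩ interior (J l) = ∅) ∧
    (∀ k, g '' I k = J k) ∧ (∀ k, ∀ x ∈ I k, φ^[m k] (g x) = φ^[n k] x)

/-- `x` is a nonexpandable point for the action of `T_φ`: `g′(x) ≤ 1` for every
`g ∈ T_φ` (derivatives are computed via lifts). -/
def NonExpandable (φ : UnitAddCircle → UnitAddCircle) (F : ℝ → ℝ)
    (x : UnitAddCircle) : Prop :=
  ∀ g G, InThompsonGroup φ F g → IsOPLift g G →
    ∀ x' : ℝ, (x' : UnitAddCircle) = x → deriv G x' ≤ 1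

/-- `I` is nice for `φ`: no forward iterate of the boundary returns to the interior. -/
def IsNice (φ : UnitAddCircle → UnitAddCircle) (I : Set UnitAddCircle) : Prop :=
  ∀ n : ℕ, 1 ≤ n → (φ^[n]) '' (frontier I) ∩ interior I = ∅

/-- A nice interval: a proper nondegenerate closed arc that is nice. -/
def IsNiceInterval (φ : UnitAddCircle → UnitAddCircle) (I : Set UnitAddCircle) : Prop :=
  (∃ a ℓ : ℝ, 0 < ℓ ∧ ℓ < 1 ∧ I = closedArc a ℓ) ∧ IsNice φ I

/-- `J` is a connected component of `S`. -/
def IsComponentOf (J S : Set UnitAddCircle) : Prop :=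
  ∃ x ∈ S, J = connectedComponentIn S x

/-- The set of left endpoints of connected components of `𝕊¹ \ Λ`. -/
def leftEndpoints (Λ : Set UnitAddCircle) : Set UnitAddCircle :=
  {z | ∃ C : Set UnitAddCircle, IsComponentOf C (Set.univ \ Λ) ∧
    ∃ a ℓ : ℝ, 0 < ℓ ∧ ℓ ≤ 1 ∧ C = openArc a ℓ ∧ z = (a : UnitAddCircle)}

/-- The set of right endpoints of connected components of `𝕊¹ \ Λ`. -/
def rightEndpoints (Λ : Set UnitAddCircle) : Set UnitAddCircle :=
  {z | ∃ C : Set UnitAddCircle, IsComponentOf C (Set.univ \ Λ) ∧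
    ∃ a ℓ : ℝ, 0 < ℓ ∧ ℓ ≤ 1 ∧ C = openArc a ℓ ∧ z = ((a + ℓ : ℝ) : UnitAddCircle)}

/-- `x` is a parabolic periodic point of `φ`: `φ^s(x) = x` and `(φ^s)′(x) = 1`
(the derivative computed via the lift `F`). -/
def IsParabolicPeriodicPt (φ : UnitAddCircle → UnitAddCircle) (F : ℝ → ℝ)
    (x : UnitAddCircle) : Prop :=
  ∃ s : ℕ, 1 ≤ s ∧ φ^[s] x = x ∧
    ∀ x' : ℝ, (x' : UnitAddCircle) = x → deriv (F^[s]) x' = 1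

/-- `c` is a limit point modulo one of the doubling orbit of `θ`. -/
def IsOmegaPt (θ c : ℝ) : Prop :=
  ∀ ε > 0, ∀ N : ℕ, ∃ n ≥ N, ∃ m : ℤ, |2 ^ n * θ - m - c| < ε

/-- `c` is periodic modulo one under doubling. -/
def DoublingPeriodic (c : ℝ) : Prop := ∃ t ≥ 1, ∃ m : ℤ, 2 ^ t * c = c + m

theorem exists_isOmegaPt_of_frequently {θ a b : ℝ}
    (h : ∀ N : ℕ, ∃ n ≥ N, ∃ m : ℤ, 2 ^ n * θ - m ∈ Icc a b) :
    ∃ c ∈ Icc a b, IsOmegaPt θ c := by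
  choose n hn m hm using h
  obtain ⟨c, hc, f, hf, hlim⟩ := isCompact_Icc.tendsto_subseq hm
  refine ⟨c, hc, fun ε hε N => ?_⟩
  obtain ⟨k, hk⟩ := Metric.tendsto_atTop.1 hlim ε hε
  refine ⟨n (f (max k N)), ?_, m (f (max k N)), ?_⟩
  · exact ((le_max_right k N).trans (hf.id_le _)).trans (hn _)
  · have := hk (max k N) (le_max_left _ _)
    rwa [Real.dist_eq] at this

theorem exists_isOmegaPt (θ : ℝ) : ∃ c, IsOmegaPt θ c := by
  obtain ⟨c, -, hc⟩ := exists_isOmegaPt_of_frequently (θ := θ) (a := 0) (b := 1)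
    fun N => ⟨N, le_rfl, ⌊2 ^ N * θ⌋, by
      have h1 := Int.floor_le (2 ^ N * θ)
      have h2 := Int.lt_floor_add_one (2 ^ N * θ)
      constructor <;> linarith⟩
  exact ⟨c, hc⟩

theorem exists_forall_ge_of_not_isOmegaPt {θ c : ℝ} (h : ¬ IsOmegaPt θ c) :
    ∃ ε > 0, ∃ N : ℕ, ∀ n ≥ N, ∀ m : ℤ, ε ≤ |2 ^ n * θ - m - c| := by
  unfold IsOmegaPt at h
  push Not at h
  exact h

theorem isClosed_setOf_isOmegaPt (θ : ℝ) : IsClosed {c | IsOmegaPt θ c} := by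
  rw [← isOpen_compl_iff, Metric.isOpen_iff]
  intro c hc
  obtain ⟨ε, hε, N, hN⟩ := exists_forall_ge_of_not_isOmegaPt hc
  refine ⟨ε / 2, by positivity, fun c' hc' hω => ?_⟩
  obtain ⟨n, hn, m, hm⟩ := hω (ε / 2) (by positivity) N
  have h1 := hN n hn m
  rw [Metric.mem_ball, Real.dist_eq] at hc'
  have h2 : 2 ^ n * θ - m - c = (2 ^ n * θ - m - c') + (c' - c) := by ring
  rw [h2] at h1
  linarith [abs_add_le (2 ^ n * θ - m - c') (c' - c)]

theorem IsOmegaPt.two_mul {θ c : ℝ} (h : IsOmegaPt θ c) : IsOmegaPt θ (2 * c) := by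
  intro ε hε N
  obtain ⟨n, hn, m, hm⟩ := h (ε / 2) (by positivity) N
  refine ⟨n + 1, by omega, 2 * m, ?_⟩
  have : (2 : ℝ) ^ (n + 1) * θ - ((2 * m : ℤ) : ℝ) - 2 * c = 2 * (2 ^ n * θ - m - c) := by
    push_cast; ring
  rw [this, abs_mul, abs_two]
  linarith

theorem IsOmegaPt.pow_mul {θ c : ℝ} (h : IsOmegaPt θ c) (r : ℕ) : IsOmegaPt θ (2 ^ r * c) := by
  induction r with
  | zero => simpa using h
  | succ r ih => simpa [pow_succ', mul_assoc] using ih.two_mul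

theorem IsOmegaPt.sub_int {θ c : ℝ} (h : IsOmegaPt θ c) (k : ℤ) : IsOmegaPt θ (c - k) := by
  intro ε hε N
  obtain ⟨n, hn, m, hm⟩ := h ε hε N
  refine ⟨n, hn, m + k, ?_⟩
  have : (2 : ℝ) ^ n * θ - ((m + k : ℤ) : ℝ) - (c - k) = 2 ^ n * θ - m - c := by
    push_cast; ring
  rwa [this]

theorem IsOmegaPt.of_add_int {θ c : ℝ} {k : ℤ} (h : IsOmegaPt θ (c + k)) : IsOmegaPt θ c := by
  simpa using h.sub_int k

theorem pow_mul_eq_add_int_iterate {c : ℝ} {t : ℕ} {m : ℤ} (h : 2 ^ t * c = c + m) (j : ℕ) :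
    ∃ m' : ℤ, 2 ^ (t * j) * c = c + m' := by
  induction j with
  | zero => exact ⟨0, by simp⟩
  | succ j ih =>
    obtain ⟨m', hm'⟩ := ih
    refine ⟨m + 2 ^ t * m', ?_⟩
    rw [mul_add, mul_one, add_comm, pow_add, mul_assoc, hm']
    push_cast
    linear_combination h

theorem DoublingPeriodic.two_mul {c : ℝ} (h : DoublingPeriodic c) : DoublingPeriodic (2 * c) := by
  obtain ⟨t, ht, m, hm⟩ := h
  exact ⟨t, ht, 2 * m, by push_cast; linear_combination 2 * hm⟩

theorem DoublingPeriodic.pow_mul {c : ℝ} (h : DoublingPeriodic c) (j : ℕ) :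
    DoublingPeriodic (2 ^ j * c) := by
  induction j with
  | zero => simpa using h
  | succ j ih => simpa [pow_succ', mul_assoc] using ih.two_mul

/-- Of the two preimages of a point under doubling, at most one is periodic. -/
theorem DoublingPeriodic.not_add_half {c : ℝ} (h : DoublingPeriodic c) :
    ¬ DoublingPeriodic (c + 1 / 2) := by
  rintro ⟨t', ht', m', hm'⟩
  obtain ⟨t, ht, m, hm⟩ := h
  obtain ⟨k, hk⟩ := pow_mul_eq_add_int_iterate hm t'
  obtain ⟨k', hk'⟩ := pow_mul_eq_add_int_iterate hm' t
  rw [mul_comm t' t, mul_add] at hk'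
  obtain ⟨e, he⟩ : ∃ e, t * t' = e + 1 := ⟨t * t' - 1, by
    have : 0 < t * t' := by positivity
    omega⟩
  rw [he] at hk hk'
  have h3 : (2 : ℝ) ^ (e + 1) * (1 / 2) = 2 ^ e := by ring
  have h4 : (2 * (2 ^ e : ℤ) + 2 * k - 2 * k' : ℝ) = 1 := by push_cast; linarith
  have h5 : (2 * (2 ^ e : ℤ) + 2 * k - 2 * k' : ℤ) = 1 := by exact_mod_cast h4
  omega

theorem DoublingPeriodic.of_half_avoided {θ ζ : ℝ} (hζ : IsOmegaPt θ ζ) (hp : DoublingPeriodic ζ)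
    (h : ∀ j : ℕ, ¬ IsOmegaPt θ (2 ^ j * ζ + 1 / 2)) : ∃ n : ℕ, DoublingPeriodic (2 ^ n * θ) := by
  obtain ⟨t, ht, m₀, hm₀⟩ := hp
  have hshift : ∀ i j : ℕ, ∃ m : ℤ, 2 ^ (j + t * i) * ζ = 2 ^ j * ζ + m := by
    intro i j
    obtain ⟨m, hm⟩ := pow_mul_eq_add_int_iterate hm₀ i
    refine ⟨2 ^ j * m, ?_⟩
    rw [pow_add, mul_assoc, hm]; push_cast; ring
  obtain ⟨ε, hε, N, hN⟩ : ∃ ε > 0, ∃ N : ℕ, ∀ n ≥ N, ∀ j : ℕ, ∀ m : ℤ,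
      ε ≤ |2 ^ n * θ - m - (2 ^ j * ζ + 1 / 2)| := by
    choose ε hε N hN using fun j => exists_forall_ge_of_not_isOmegaPt (h j)
    have hne : (Finset.range t).Nonempty := ⟨0, by simp; omega⟩
    refine ⟨(Finset.range t).inf' hne ε, (Finset.lt_inf'_iff hne).2 fun j _ => hε j,
      (Finset.range t).sup N, fun n hn j m => ?_⟩
    have hjt : j % t ∈ Finset.range t := Finset.mem_range.2 (Nat.mod_lt _ (by omega))
    obtain ⟨m', hm'⟩ := hshift (j / t) (j % t)
    rw [Nat.mod_add_div] at hm'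
    have h1 := hN (j % t) n ((Finset.le_sup hjt).trans hn) (m + m')
    have h2 := Finset.inf'_le ε hjt
    rw [hm']
    push_cast at h1
    have h3 : 2 ^ n * θ - m - (2 ^ (j % t) * ζ + m' + 1 / 2)
      = 2 ^ n * θ - (m + m') - (2 ^ (j % t) * ζ + 1 / 2) := by ring
    rw [h3]
    linarith
  have hstep : ∀ n ≥ N, ∀ δ ≤ 2 * ε,
      (∃ j : ℕ, ∃ m : ℤ, |2 ^ (n + 1) * θ - m - 2 ^ j * ζ| < δ) →
      ∃ j : ℕ, ∃ m : ℤ, |2 ^ n * θ - m - 2 ^ j * ζ| < δ / 2 := by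
    rintro n hn δ hδ ⟨j, m, hjm⟩
    obtain ⟨m', hm'⟩ := hshift 1 j
    obtain ⟨j', hj'⟩ : ∃ j', j + t * 1 = j' + 1 := ⟨j + t - 1, by omega⟩
    rw [hj'] at hm'
    have h1 : |2 ^ n * θ - ((m - m' : ℤ) : ℝ) / 2 - 2 ^ j' * ζ| < δ / 2 := by
      have : 2 ^ n * θ - ((m - m' : ℤ) : ℝ) / 2 - 2 ^ j' * ζ
          = (2 ^ (n + 1) * θ - m - 2 ^ j * ζ) / 2 := by
        push_cast
        linear_combination -(1 / 2) * hm'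
      rw [this, abs_div, abs_two]
      linarith
    rcases Int.even_or_odd' (m - m') with ⟨q, hq | hq⟩
    · refine ⟨j', q, ?_⟩
      rw [hq] at h1
      push_cast at h1
      rwa [show (2 : ℝ) * q / 2 = q by ring] at h1
    · exfalso
      have h2 := hN n hn j' q
      rw [hq] at h1
      push_cast at h1
      have h3 : 2 ^ n * θ - q - (2 ^ j' * ζ + 1 / 2)
        = 2 ^ n * θ - (2 * q + 1) / 2 - 2 ^ j' * ζ := by ring
      rw [h3] at h2
      linarith
  have hback : ∀ i : ℕ, ∀ δ ≤ 2 * ε, 0 < δ →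
      (∃ j : ℕ, ∃ m : ℤ, |2 ^ (N + i) * θ - m - 2 ^ j * ζ| < δ) →
      ∃ j : ℕ, ∃ m : ℤ, |2 ^ N * θ - m - 2 ^ j * ζ| < δ / 2 ^ i := by
    intro i
    induction i with
    | zero => intro δ _ _ h; simpa using h
    | succ i ih =>
      intro δ hδ hδ0 h
      have := ih (δ / 2) (by linarith) (by linarith) (hstep (N + i) (by omega) δ hδ h)
      rwa [div_div, ← pow_succ'] at this
  have hclose : ∀ δ > 0, ∃ j : ℕ, ∃ m : ℤ, |2 ^ N * θ - m - 2 ^ j * ζ| < δ := by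
    intro δ hδ
    obtain ⟨i, hi⟩ := exists_nat_gt (2 * ε / δ)
    obtain ⟨n, hn, m, hm⟩ := hζ (2 * ε) (by positivity) (N + i)
    obtain ⟨e, rfl⟩ : ∃ e, n = N + e := ⟨n - N, by omega⟩
    obtain ⟨j, m', hj⟩ := hback e (2 * ε) le_rfl (by positivity) ⟨0, m, by simpa using hm⟩
    refine ⟨j, m', hj.trans_le ?_⟩
    rw [div_le_iff₀ (by positivity)]
    have h1 : (i : ℝ) ≤ e := by exact_mod_cast (by omega : i ≤ e)
    have h2 : (e : ℝ) < 2 ^ e := by exact_mod_cast Nat.lt_two_pow_self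
    rw [div_lt_iff₀ hδ] at hi
    nlinarith
  refine ⟨N, t, ht, ?_⟩
  -- `(2 ^ t - 1) * 2 ^ N * θ` is a limit of integers
  have hlim : ∀ δ > 0, ∃ q : ℤ, |(2 ^ t - 1) * (2 ^ N * θ) - q| < δ := by
    intro δ hδ
    have hpos : (0 : ℝ) < 2 ^ t := by positivity
    obtain ⟨j, m, hj⟩ := hclose (δ / 2 ^ t) (by positivity)
    refine ⟨(2 ^ t - 1) * m + 2 ^ j * m₀, ?_⟩
    have : (2 ^ t - 1) * (2 ^ N * θ) - (((2 ^ t - 1) * m + 2 ^ j * m₀ : ℤ) : ℝ)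
        = (2 ^ t - 1) * (2 ^ N * θ - m - 2 ^ j * ζ) := by
      push_cast
      linear_combination (2 : ℝ) ^ j * hm₀
    have h1 : (1 : ℝ) ≤ 2 ^ t := one_le_pow₀ (by norm_num)
    rw [this, abs_mul, abs_of_nonneg (by linarith)]
    rw [lt_div_iff₀ hpos] at hj
    nlinarith [abs_nonneg (2 ^ N * θ - m - 2 ^ j * ζ)]
  obtain ⟨q, hq⟩ : (2 ^ t - 1) * (2 ^ N * θ) ∈ range ((↑) : ℤ → ℝ) := by
    have hcl : IsClosed (range ((↑) : ℤ → ℝ)) := Int.isClosedEmbedding_coe_real.isClosed_range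
    rw [← hcl.closure_eq, Metric.mem_closure_iff]
    intro δ hδ
    obtain ⟨q, hq⟩ := hlim δ hδ
    exact ⟨q, ⟨q, rfl⟩, by rwa [Real.dist_eq]⟩
  exact ⟨q, by linear_combination -hq⟩

/-- The limit set of a doubling orbit that is not preperiodic, if it is not everything, has a
nonperiodic point isolated from the left. -/
theorem exists_leftIsolated_not_periodic {θ : ℝ} (hθ : ∀ n : ℕ, ¬ DoublingPeriodic (2 ^ n * θ))
    {y₀ : ℝ} (hy₀ : ¬ IsOmegaPt θ y₀) :
    ∃ ζ y, IsOmegaPt θ ζ ∧ y < ζ ∧ (∀ c, y < c → c < ζ → ¬ IsOmegaPt θ c) ∧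
      ¬ DoublingPeriodic ζ := by
  by_contra! hall
  have hper : ∀ ζ y, IsOmegaPt θ ζ → y < ζ → (∀ c, y < c → c < ζ → ¬ IsOmegaPt θ c) →
      DoublingPeriodic ζ := fun ζ y h1 h2 h3 => hall ζ y h1 h2 h3
  have hpre : ∀ (ζ c : ℝ) (m : ℤ), 2 * c = ζ + m →
      (∃ y < ζ, ∀ c : ℝ, y < c → c < ζ → ¬ IsOmegaPt θ c) →
      ∃ y < c, ∀ c' : ℝ, y < c' → c' < c → ¬ IsOmegaPt θ c' := by
    rintro ζ c m hc ⟨y, hy, hgap⟩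
    refine ⟨c - (ζ - y) / 2, by linarith, fun c' h1 h2 hω => ?_⟩
    exact hgap (2 * c' - m) (by linarith) (by linarith) (hω.two_mul.sub_int m)
  obtain ⟨c₀, hc₀⟩ := exists_isOmegaPt θ
  obtain ⟨k, hk⟩ := exists_int_gt (y₀ - c₀)
  have hne : ({c | IsOmegaPt θ c} ∩ Ici y₀).Nonempty :=
    ⟨c₀ + k, IsOmegaPt.of_add_int (k := -k) (by simpa using hc₀), by simp; linarith⟩
  have hbdd : BddBelow ({c | IsOmegaPt θ c} ∩ Ici y₀) := ⟨y₀, fun _ h => h.2⟩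
  obtain ⟨hζ, hζy⟩ := ((isClosed_setOf_isOmegaPt θ).inter isClosed_Ici).csInf_mem hne hbdd
  set ζ := sInf ({c | IsOmegaPt θ c} ∩ Ici y₀) with hζdef
  have hlt : y₀ < ζ := lt_of_le_of_ne hζy fun h => hy₀ (by rw [h]; exact hζ)
  have hiso : ∃ y < ζ, ∀ c, y < c → c < ζ → ¬ IsOmegaPt θ c :=
    ⟨y₀, hlt, fun c h1 h2 hω => notMem_of_lt_csInf h2 hbdd ⟨hω, h1.le⟩⟩
  have hperζ : DoublingPeriodic ζ := by
    obtain ⟨y, h1, h2⟩ := hiso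
    exact hper ζ y hζ h1 h2
  obtain ⟨t, ht, m₀, hm₀⟩ := id hperζ
  -- every point of the orbit of `ζ` is isolated from the left
  have hdesc : ∀ (i : ℕ) (c : ℝ) (m : ℤ), 2 ^ i * c = ζ + m →
      ∃ y < c, ∀ c', y < c' → c' < c → ¬ IsOmegaPt θ c' := by
    intro i
    induction i with
    | zero =>
      intro c m hc
      obtain ⟨y, hy, hgap⟩ := hiso
      refine ⟨y + m, by simp at hc; linarith, fun c' h1 h2 hω => ?_⟩
      simp at hc
      exact hgap (c' - m) (by linarith) (by linarith) (hω.sub_int m)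
    | succ i ih =>
      intro c m hc
      exact hpre (2 * c) c 0 (by simp) (ih (2 * c) m (by rw [← hc]; ring))
  obtain ⟨n, hn⟩ := DoublingPeriodic.of_half_avoided hζ hperζ fun j hω => by
    obtain ⟨m, hm⟩ := pow_mul_eq_add_int_iterate hm₀ (j + 1)
    obtain ⟨i, hi⟩ : ∃ i, t * (j + 1) = i + 1 + j := ⟨t * (j + 1) - 1 - j, by
      have : j + 1 ≤ t * (j + 1) := Nat.le_mul_of_pos_left _ ht
      omega⟩
    have h1 : 2 ^ (i + 1) * (2 ^ j * ζ + 1 / 2) = ζ + ((m + 2 ^ i : ℤ) : ℝ) := by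
      rw [hi] at hm
      push_cast
      have : (2 : ℝ) ^ (i + 1) * (2 ^ j * ζ + 1 / 2) = 2 ^ (i + 1 + j) * ζ + 2 ^ i := by ring
      rw [this, hm]; ring
    obtain ⟨y, hy, hgap⟩ := hdesc _ _ _ h1
    exact (hperζ.pow_mul j).not_add_half (hper _ y hω hy hgap)
  exact hθ n hn

/-- The forward doubling orbits of `α` and `β` never enter the interval `(α, β)` modulo one. -/
def DoublingNice (α β : ℝ) : Prop :=
  ∀ r ≥ 1, ∀ m : ℤ, ¬ (α < 2 ^ r * α - m ∧ 2 ^ r * α - m < β) ∧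
    ¬ (α < 2 ^ r * β - m ∧ 2 ^ r * β - m < β)

theorem DoublingNice.pullback_subset {α β a b : ℝ} {r : ℕ} {k m : ℤ} (h : DoublingNice α β)
    (hr : 1 ≤ r) (ha : 2 ^ r * a = α + k) (hb : 2 ^ r * b = β + k) (h1 : α + m < b)
    (h2 : a < β + m) : α + m ≤ a ∧ b ≤ β + m := by
  have hp : (0 : ℝ) < 2 ^ r := by positivity
  constructor
  · by_contra! hlt
    have e1 := mul_lt_mul_of_pos_left hlt hp
    have e2 := mul_lt_mul_of_pos_left h1 hp
    refine (h r hr (k - 2 ^ r * m)).1 ?_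
    push_cast
    constructor <;> linarith
  · by_contra! hlt
    have e1 := mul_lt_mul_of_pos_left hlt hp
    have e2 := mul_lt_mul_of_pos_left h2 hp
    refine (h r hr (k - 2 ^ r * m)).2 ?_
    push_cast
    constructor <;> linarith

/-- The forward images of a first return branch to a nice interval are disjoint modulo one. -/
theorem DoublingNice.firstReturn_disjoint {α β a b y : ℝ} {t : ℕ} {k : ℤ} (h : DoublingNice α β)
    (ha : 2 ^ t * a = α + k) (hb : 2 ^ t * b = β + k) (hay : a < y) (hyb : y < b)
    (hfirst : ∀ t', 0 < t' → t' < t → ∀ m : ℤ, ¬ (α < 2 ^ t' * y - m ∧ 2 ^ t' * y - m < β))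
    {i j : ℕ} (hij : i < j) (hj : j < t) (m : ℤ) :
    2 ^ i * b ≤ 2 ^ j * a + m ∨ 2 ^ j * b + m ≤ 2 ^ i * a := by
  by_contra! hcon
  obtain ⟨h1, h2⟩ := hcon
  obtain ⟨d, rfl⟩ : ∃ d, j = i + d := ⟨j - i, by omega⟩
  obtain ⟨e, rfl⟩ : ∃ e, t = e + (i + d) := ⟨t - (i + d), by omega⟩
  have hp : (0 : ℝ) < 2 ^ e := by positivity
  have hp' : (0 : ℝ) < 2 ^ (e + i) := by positivity
  have e1 := mul_lt_mul_of_pos_left h1 hp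
  have e2 := mul_lt_mul_of_pos_left h2 hp
  obtain ⟨h3, h4⟩ := h.pullback_subset (r := d) (k := k) (m := k + 2 ^ e * m)
    (a := 2 ^ (e + i) * a) (b := 2 ^ (e + i) * b) (by omega)
    (by rw [← ha]; ring) (by rw [← hb]; ring)
    (by push_cast; rw [pow_add] at ha ⊢; linarith)
    (by push_cast; rw [pow_add] at hb ⊢; linarith)
  have e3 := mul_lt_mul_of_pos_left hay hp'
  have e4 := mul_lt_mul_of_pos_left hyb hp'
  exact hfirst (e + i) (by omega) (by omega) (k + 2 ^ e * m) ⟨by linarith, by linarith⟩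

/-- The real numbers `j / (3 * 2 ^ n)`, where divisibility of `j` by `3` is prescribed by `q`. -/
def Marker (q : Prop) (n : ℕ) (c : ℝ) : Prop := ∃ j : ℤ, (3 ∣ j ↔ q) ∧ 3 * 2 ^ n * c = j

theorem Marker.neg {q : Prop} {n : ℕ} {c : ℝ} (h : Marker q n c) : Marker q n (-c) := by
  obtain ⟨j, hj, hc⟩ := h
  exact ⟨-j, by rw [dvd_neg]; exact hj, by push_cast; rw [← hc]; ring⟩

theorem Marker.sub_int {q : Prop} {n : ℕ} {c : ℝ} (h : Marker q n c) (m : ℤ) :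
    Marker q n (c - m) := by
  obtain ⟨j, hj, hc⟩ := h
  refine ⟨j - 3 * (2 ^ n * m), ?_, by push_cast; rw [← hc]; ring⟩
  rw [← hj]; omega

theorem Marker.succ {q : Prop} {n : ℕ} {c : ℝ} (h : Marker q n c) : Marker q (n + 1) c := by
  obtain ⟨j, hj, hc⟩ := h
  refine ⟨2 * j, ?_, by push_cast; rw [← hc]; ring⟩
  rw [← hj]; omega

theorem Marker.mono {q : Prop} {n n' : ℕ} {c : ℝ} (h : Marker q n c) (hn : n ≤ n') :
    Marker q n' c := by
  induction n', hn using Nat.le_induction with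
  | base => exact h
  | succ k _ ih => exact ih.succ

theorem marker_pow_mul {q : Prop} {n r : ℕ} {c : ℝ} :
    Marker q n (2 ^ r * c) ↔ Marker q (n + r) c := by
  unfold Marker
  rw [show (3 : ℝ) * 2 ^ n * (2 ^ r * c) = 3 * 2 ^ (n + r) * c by ring]

theorem exists_forall_not_marker (ζ : ℝ) : ∃ q : Prop, ∀ n, ¬ Marker q n ζ := by
  by_contra! h
  obtain ⟨n, j, hj, hc⟩ := h True
  obtain ⟨n', j', hj', hc'⟩ := h False
  have h1 : (2 ^ n * j' : ℝ) = 2 ^ n' * j := by rw [← hc, ← hc']; ring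
  have h2 : (2 ^ n * j' : ℤ) = 2 ^ n' * j := by exact_mod_cast h1
  have h3 : (3 : ℤ) ∣ 2 ^ n * j' := by
    rw [h2]; exact Dvd.dvd.mul_left (by simpa using hj) _
  have h4 : IsCoprime (3 : ℤ) (2 ^ n) := IsCoprime.pow_right (by norm_num)
  exact hj'.1 (h4.dvd_of_dvd_mul_left h3)

theorem exists_left_marker {q : Prop} {n : ℕ} {ζ : ℝ} (hζ : ¬ Marker q n ζ) :
    ∃ u < ζ, Marker q n u ∧ ζ - u < 1 / 2 ^ n ∧ ∀ c, u < c → c < ζ → ¬ Marker q n c := by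
  classical
  set x : ℝ := 3 * 2 ^ n * ζ with hx
  have hp : (0 : ℝ) < 3 * 2 ^ n := by positivity
  obtain ⟨j₀, hj₀, hj₀x, hj₀'⟩ : ∃ j : ℤ, (3 ∣ j ↔ q) ∧ (j : ℝ) ≤ x ∧ x - 3 < j := by
    have hfl := Int.floor_le x
    have hfl' := Int.lt_floor_add_one x
    obtain ⟨i, hi0, hi2, hi⟩ : ∃ i : ℤ, 0 ≤ i ∧ i ≤ 2 ∧ (3 ∣ (⌊x⌋ - i) ↔ q) := by
      by_cases hq : q
      · exact ⟨⌊x⌋ % 3, by omega, by omega, by simp only [hq, iff_true]; omega⟩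
      · simp only [hq, iff_false]
        by_cases h3 : (3 : ℤ) ∣ ⌊x⌋
        · exact ⟨1, by omega, by omega, by omega⟩
        · exact ⟨0, by omega, by omega, by omega⟩
    have hi0' : (0 : ℝ) ≤ i := by exact_mod_cast hi0
    have hi2' : (i : ℝ) ≤ 2 := by exact_mod_cast hi2
    exact ⟨⌊x⌋ - i, hi, by push_cast; linarith, by push_cast; linarith⟩
  obtain ⟨j, ⟨hjq, hjx⟩, hmax⟩ := Int.exists_greatest_of_bdd
    (P := fun j : ℤ => (3 ∣ j ↔ q) ∧ (j : ℝ) ≤ x)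
    ⟨⌊x⌋, fun z hz => Int.le_floor.2 hz.2⟩ ⟨j₀, hj₀, hj₀x⟩
  have hju : Marker q n (j / (3 * 2 ^ n)) := ⟨j, hjq, by field_simp⟩
  have hle : (j : ℝ) / (3 * 2 ^ n) ≤ ζ := by rw [div_le_iff₀ hp]; linarith
  have hjj : (j₀ : ℝ) ≤ j := by exact_mod_cast hmax j₀ ⟨hj₀, hj₀x⟩
  refine ⟨j / (3 * 2 ^ n), lt_of_le_of_ne hle fun h => hζ (h ▸ hju), hju, ?_, ?_⟩
  · rw [sub_lt_iff_lt_add]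
    have : (1 : ℝ) / 2 ^ n + j / (3 * 2 ^ n) = (3 + j) / (3 * 2 ^ n) := by field_simp
    rw [this, lt_div_iff₀ hp]
    linarith
  · rintro c hc1 hc2 ⟨i, hi, hic⟩
    have h1 : i ≤ j := hmax i ⟨hi, by rw [← hic, hx]; gcongr⟩
    have h2 : (i : ℝ) ≤ j := by exact_mod_cast h1
    rw [div_lt_iff₀ hp] at hc1
    linarith

theorem exists_right_marker {q : Prop} {n : ℕ} {ζ : ℝ} (hζ : ¬ Marker q n ζ) :
    ∃ v, ζ < v ∧ Marker q n v ∧ v - ζ < 1 / 2 ^ n ∧ ∀ c, ζ < c → c < v → ¬ Marker q n c := by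
  obtain ⟨u, h1, h2, h3, h4⟩ := exists_left_marker (ζ := -ζ)
    fun h : Marker q n (-ζ) => hζ (by simpa using h.neg)
  exact ⟨-u, by linarith, h2.neg, by linarith, fun c hc hc' hM =>
    h4 (-c) (by linarith) (by linarith) hM.neg⟩

theorem exists_nice_neighborhoods (ζ : ℝ) : ∃ u v : ℕ → ℝ,
    (∀ n, u n < ζ ∧ ζ < v n ∧ ζ - u n < 1 / 2 ^ n ∧ v n - ζ < 1 / 2 ^ n) ∧
    ∀ n₀ n, n₀ ≤ n →
      (∀ r ≥ 1, r ≤ n - n₀ → ∀ m : ℤ, ¬ (u n₀ < 2 ^ r * ζ - m ∧ 2 ^ r * ζ - m < ζ)) →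
      DoublingNice (u n₀) (v n) := by
  obtain ⟨q, hq⟩ := exists_forall_not_marker ζ
  choose u hu huM hud hugap using fun n => exists_left_marker (hq n)
  choose v hv hvM hvd hvgap using fun n => exists_right_marker (hq n)
  refine ⟨u, v, fun n => ⟨hu n, hv n, hud n, hvd n⟩, fun n₀ n hn hr r hr1 m => ?_⟩
  have hno : ∀ c, Marker q n₀ c → ¬ (u n₀ < c ∧ c < v n) := by
    rintro c hc ⟨h1, h2⟩
    rcases lt_trichotomy c ζ with h | h | h
    · exact hugap n₀ c h1 h hc
    · exact hq n₀ (h ▸ hc)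
    · exact hvgap n c h h2 (hc.mono hn)
  refine ⟨hno _ ((marker_pow_mul.2 ((huM n₀).mono (by omega))).sub_int m), ?_⟩
  by_cases hrn : n - n₀ ≤ r
  · exact hno _ ((marker_pow_mul.2 ((hvM n).mono (by omega))).sub_int m)
  · rintro ⟨h1, h2⟩
    have hM : Marker q (n - r) (2 ^ r * v n - m) :=
      (marker_pow_mul.2 ((hvM n).mono (by omega))).sub_int m
    have hpos : (0 : ℝ) < 2 ^ r := by positivity
    rcases lt_trichotomy (2 ^ r * v n - m) ζ with h | h | h
    · have hlt : 2 ^ r * ζ - m < 2 ^ r * v n - m := by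
        have := mul_lt_mul_of_pos_left (hv n) hpos
        linarith
      rcases lt_trichotomy (2 ^ r * ζ - m) (u n₀) with h3 | h3 | h3
      · have h4 : Marker q (n - r) (2 ^ r * ((u n₀ + m) / 2 ^ r)) := by
          rw [mul_div_cancel₀ _ hpos.ne']
          have := ((huM n₀).mono (show n₀ ≤ n - r by omega)).sub_int (-m)
          simpa using this
        refine hvgap n ((u n₀ + m) / 2 ^ r) ?_ ?_ ((marker_pow_mul.1 h4).mono (by omega))
        · rw [lt_div_iff₀ hpos]; linarith
        · rw [div_lt_iff₀ hpos]; linarith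
      · refine hq (n₀ + r) (marker_pow_mul.1 ?_)
        have := (huM n₀).sub_int (-m)
        rw [← h3] at this
        simpa using this
      · exact hr r hr1 (by omega) m ⟨h3, by linarith⟩
    · exact hq (n - r) (h ▸ hM)
    · exact hvgap n _ h h2 (hM.mono (by omega))

theorem map_add_int_of_map_add_one {f : ℝ → ℝ} {c : ℝ} (h : ∀ x, f (x + 1) = f x + c) (x : ℝ)
    (m : ℤ) : f (x + m) = f x + m * c := by
  have hp : Function.Periodic (fun x => f x - c * x) 1 := fun x => by simp only [h]; ring
  have := hp.int_mul m x
  simp only [mul_one] at this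
  linarith

/-- A lift of a degree two circle covering map fixing `0`. -/
structure IsDegTwoLift (F : ℝ → ℝ) : Prop where
  continuous : Continuous F
  strictMono : StrictMono F
  map_add_one : ∀ x, F (x + 1) = F x + 2
  map_zero : F 0 = 0

namespace IsDegTwoLift
variable {F : ℝ → ℝ}

theorem map_add_int (hF : IsDegTwoLift F) (x : ℝ) (m : ℤ) : F (x + m) = F x + 2 * m := by
  rw [map_add_int_of_map_add_one hF.map_add_one, mul_comm]

theorem iterate_add_int (hF : IsDegTwoLift F) (n : ℕ) (x : ℝ) (m : ℤ) :
    F^[n] (x + m) = F^[n] x + 2 ^ n * m := by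
  induction n with
  | zero => simp
  | succ n ih =>
    rw [Function.iterate_succ_apply', ih, Function.iterate_succ_apply']
    have := hF.map_add_int (F^[n] x) (2 ^ n * m)
    push_cast at this
    rw [this]; ring

theorem iterate_continuous (hF : IsDegTwoLift F) (n : ℕ) : Continuous F^[n] :=
  hF.continuous.iterate n

theorem iterate_strictMono (hF : IsDegTwoLift F) (n : ℕ) : StrictMono F^[n] :=
  hF.strictMono.iterate n

theorem iterate_zero (hF : IsDegTwoLift F) (n : ℕ) : F^[n] 0 = 0 :=
  Function.iterate_fixed hF.map_zero n

theorem iterate_int (hF : IsDegTwoLift F) (n : ℕ) (m : ℤ) : F^[n] m = 2 ^ n * m := by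
  simpa [hF.iterate_zero] using hF.iterate_add_int n 0 m

theorem iterate_surjective (hF : IsDegTwoLift F) (n : ℕ) : Function.Surjective F^[n] := by
  refine (hF.iterate_continuous n).surjective ?_ ?_
  · refine tendsto_atTop_atTop.2 fun b => ?_
    obtain ⟨m, hm⟩ := exists_nat_gt b
    refine ⟨m, fun a ha => ?_⟩
    have h1 := (hF.iterate_strictMono n).monotone ha
    have h2 := hF.iterate_int n m
    push_cast at h2
    have h3 : (1 : ℝ) ≤ 2 ^ n := one_le_pow₀ (by norm_num)
    have h4 : (0 : ℝ) ≤ m := by positivity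
    nlinarith
  · refine tendsto_atBot_atBot.2 fun b => ?_
    obtain ⟨m, hm⟩ := exists_nat_gt (-b)
    refine ⟨-m, fun a ha => ?_⟩
    have h1 := (hF.iterate_strictMono n).monotone ha
    have h2 := hF.iterate_int n (-m)
    push_cast at h2
    have h3 : (1 : ℝ) ≤ 2 ^ n := one_le_pow₀ (by norm_num)
    have h4 : (0 : ℝ) ≤ m := by positivity
    nlinarith

end IsDegTwoLift

/-- `H` is a lift of a degree one monotone map from `F` to the doubling map. -/
structure IsDoublingFactor (F H : ℝ → ℝ) : Prop where
  continuous : Continuous H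
  monotone : Monotone H
  map_add_one : ∀ x, H (x + 1) = H x + 1
  map_apply : ∀ x, H (F x) = 2 * H x

theorem IsDegTwoLift.exists_isDoublingFactor {F : ℝ → ℝ} (hF : IsDegTwoLift F) :
    ∃ H, IsDoublingFactor F H := by
  obtain ⟨C, hC⟩ : ∃ C, ∀ y, |F y - 2 * y| ≤ C := by
    have hper : Function.Periodic (fun y => F y - 2 * y) 1 := fun y => by
      simp only [hF.map_add_one]; ring
    have hcont : Continuous fun y => F y - 2 * y :=
      hF.continuous.sub (continuous_const.mul continuous_id)
    obtain ⟨C, hC⟩ := isCompact_Icc.exists_bound_of_continuousOn (s := Icc (0 : ℝ) 1)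
      hcont.continuousOn
    refine ⟨C, fun y => ?_⟩
    obtain ⟨z, hz, hyz⟩ := hper.exists_mem_Ico₀ one_pos y
    have hyz' : F y - 2 * y = F z - 2 * z := hyz
    rw [hyz']
    exact hC z (Ico_subset_Icc_self hz)
  have hdist : ∀ y n, dist (F^[n] y / 2 ^ n) (F^[n + 1] y / 2 ^ (n + 1)) ≤ C / 2 / 2 ^ n := by
    intro y n
    rw [Function.iterate_succ_apply', dist_comm, Real.dist_eq]
    have : F (F^[n] y) / 2 ^ (n + 1) - F^[n] y / 2 ^ n
        = (F (F^[n] y) - 2 * F^[n] y) / 2 / 2 ^ n := by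
      rw [pow_succ]; field_simp
    rw [this, abs_div, abs_div, abs_two, abs_of_pos (show (0 : ℝ) < 2 ^ n by positivity)]
    gcongr
    exact hC _
  choose H hH using fun y => cauchySeq_tendsto_of_complete (cauchySeq_of_le_geometric_two (hdist y))
  have hunif : TendstoUniformly (fun n y => F^[n] y / 2 ^ n) H atTop := by
    rw [Metric.tendstoUniformly_iff]
    intro ε hε
    have hlim : Tendsto (fun n : ℕ => C / 2 ^ n) atTop (𝓝 0) := by
      simpa [div_eq_mul_inv] using
        (tendsto_pow_atTop_nhds_zero_of_lt_one (r := (2 : ℝ)⁻¹) (by norm_num)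
          (by norm_num)).const_mul C
    filter_upwards [hlim.eventually_lt_const hε] with n hn y
    rw [dist_comm]
    exact (dist_le_of_le_geometric_two_of_tendsto (hdist y) (hH y) n).trans_lt hn
  refine ⟨H, hunif.continuous (Eventually.of_forall fun n =>
    (hF.iterate_continuous n).div_const _).frequently, ?_, ?_, ?_⟩
  · intro y z hyz
    refine le_of_tendsto_of_tendsto' (hH y) (hH z) fun n => ?_
    have := (hF.iterate_strictMono n).monotone hyz
    gcongr
  · intro y
    refine tendsto_nhds_unique (hH (y + 1)) ?_
    refine ((hH y).add_const 1).congr fun n => ?_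
    have := hF.iterate_add_int n y 1
    push_cast at this
    rw [this]
    field_simp
  · intro y
    refine tendsto_nhds_unique (hH (F y)) ?_
    refine (((tendsto_add_atTop_iff_nat 1).2 (hH y)).const_mul 2).congr fun n => ?_
    rw [Function.iterate_succ_apply]
    field_simp
    ring

/-- The left endpoint of the fibre of `H` over `c`. -/
def fiberLeft (H : ℝ → ℝ) (c : ℝ) : ℝ := sInf {y | c ≤ H y}

/-- The right endpoint of the fibre of `H` over `c`. -/
def fiberRight (H : ℝ → ℝ) (c : ℝ) : ℝ := sSup {y | H y ≤ c}

namespace IsDoublingFactor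
variable {F H : ℝ → ℝ}

theorem map_add_int (hH : IsDoublingFactor F H) (x : ℝ) (m : ℤ) : H (x + m) = H x + m := by
  simpa using map_add_int_of_map_add_one hH.map_add_one x m

theorem map_iterate (hH : IsDoublingFactor F H) (n : ℕ) (x : ℝ) : H (F^[n] x) = 2 ^ n * H x := by
  induction n with
  | zero => simp
  | succ n ih => rw [Function.iterate_succ_apply', hH.map_apply, ih, pow_succ']; ring

theorem surjective (hH : IsDoublingFactor F H) : Function.Surjective H := by
  refine hH.continuous.surjective ?_ ?_
  · refine tendsto_atTop_atTop.2 fun b => ?_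
    obtain ⟨m, hm⟩ := exists_int_gt (b - H 0)
    refine ⟨m, fun a ha => ?_⟩
    have h1 := hH.monotone ha
    have h2 := hH.map_add_int 0 m
    rw [zero_add] at h2
    linarith
  · refine tendsto_atBot_atBot.2 fun b => ?_
    obtain ⟨m, hm⟩ := exists_int_lt (b - H 0)
    refine ⟨m, fun a ha => ?_⟩
    have h1 := hH.monotone ha
    have h2 := hH.map_add_int 0 m
    rw [zero_add] at h2
    linarith

theorem map_fiberLeft_and (hH : IsDoublingFactor F H) (c : ℝ) :
    H (fiberLeft H c) = c ∧ ∀ y, c ≤ H y → fiberLeft H c ≤ y := by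
  have hbdd : BddBelow {y | c ≤ H y} := by
    obtain ⟨z, hz⟩ := hH.surjective (c - 1)
    refine ⟨z, fun y hy => ?_⟩
    by_contra! h
    have h1 := hH.monotone h.le
    have h2 : c ≤ H y := hy
    linarith
  obtain ⟨z, hz⟩ := hH.surjective c
  have hmem : fiberLeft H c ∈ {y | c ≤ H y} :=
    (isClosed_le continuous_const hH.continuous).csInf_mem ⟨z, hz.ge⟩ hbdd
  have hle : ∀ y, c ≤ H y → fiberLeft H c ≤ y := fun y hy => csInf_le hbdd hy
  exact ⟨le_antisymm ((hH.monotone (hle z hz.ge)).trans hz.le) hmem, hle⟩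

theorem map_fiberRight_and (hH : IsDoublingFactor F H) (c : ℝ) :
    H (fiberRight H c) = c ∧ ∀ y, H y ≤ c → y ≤ fiberRight H c := by
  have hbdd : BddAbove {y | H y ≤ c} := by
    obtain ⟨z, hz⟩ := hH.surjective (c + 1)
    refine ⟨z, fun y hy => ?_⟩
    by_contra! h
    have h1 := hH.monotone h.le
    have h2 : H y ≤ c := hy
    linarith
  obtain ⟨z, hz⟩ := hH.surjective c
  have hmem : fiberRight H c ∈ {y | H y ≤ c} :=
    (isClosed_le hH.continuous continuous_const).csSup_mem ⟨z, hz.le⟩ hbdd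
  have hle : ∀ y, H y ≤ c → y ≤ fiberRight H c := fun y hy => le_csSup hbdd hy
  exact ⟨le_antisymm hmem (hz.ge.trans (hH.monotone (hle z hz.le))), hle⟩

theorem map_fiberLeft (hH : IsDoublingFactor F H) (c : ℝ) : H (fiberLeft H c) = c :=
  (hH.map_fiberLeft_and c).1

theorem map_fiberRight (hH : IsDoublingFactor F H) (c : ℝ) : H (fiberRight H c) = c :=
  (hH.map_fiberRight_and c).1

theorem fiberLeft_le_iff (hH : IsDoublingFactor F H) {c y : ℝ} : fiberLeft H c ≤ y ↔ c ≤ H y :=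
  ⟨fun h => (hH.map_fiberLeft c).symm.le.trans (hH.monotone h), (hH.map_fiberLeft_and c).2 y⟩

theorem le_fiberRight_iff (hH : IsDoublingFactor F H) {c y : ℝ} : y ≤ fiberRight H c ↔ H y ≤ c :=
  ⟨fun h => (hH.monotone h).trans (hH.map_fiberRight c).le, (hH.map_fiberRight_and c).2 y⟩

theorem lt_fiberLeft_iff (hH : IsDoublingFactor F H) {c y : ℝ} : y < fiberLeft H c ↔ H y < c := by
  rw [← not_le, hH.fiberLeft_le_iff, not_le]

theorem fiberRight_lt_iff (hH : IsDoublingFactor F H) {c y : ℝ} :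
    fiberRight H c < y ↔ c < H y := by
  rw [← not_le, hH.le_fiberRight_iff, not_le]

theorem fiberLeft_le_fiberRight (hH : IsDoublingFactor F H) (c : ℝ) :
    fiberLeft H c ≤ fiberRight H c := by
  rw [hH.fiberLeft_le_iff, hH.map_fiberRight]

theorem fiberRight_lt_fiberLeft (hH : IsDoublingFactor F H) {c d : ℝ} (h : c < d) :
    fiberRight H c < fiberLeft H d := by
  rwa [hH.fiberRight_lt_iff, hH.map_fiberLeft]

theorem fiberLeft_strictMono (hH : IsDoublingFactor F H) : StrictMono (fiberLeft H) :=
  fun _ _ h => (hH.fiberLeft_le_fiberRight _).trans_lt (hH.fiberRight_lt_fiberLeft h)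

theorem fiberLeft_add_int (hH : IsDoublingFactor F H) (c : ℝ) (m : ℤ) :
    fiberLeft H (c + m) = fiberLeft H c + m := by
  refine eq_of_forall_ge_iff fun y => ?_
  have h := hH.map_add_int (y - m) m
  rw [sub_add_cancel] at h
  rw [← le_sub_iff_add_le, hH.fiberLeft_le_iff, hH.fiberLeft_le_iff, h]
  constructor <;> intro <;> linarith

theorem fiberRight_add_int (hH : IsDoublingFactor F H) (c : ℝ) (m : ℤ) :
    fiberRight H (c + m) = fiberRight H c + m := by
  refine eq_of_forall_le_iff fun y => ?_
  have h := hH.map_add_int (y - m) m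
  rw [sub_add_cancel] at h
  rw [← sub_le_iff_le_add, hH.le_fiberRight_iff, hH.le_fiberRight_iff, h]
  constructor <;> intro <;> linarith

theorem apply_fiberLeft (hF : IsDegTwoLift F) (hH : IsDoublingFactor F H) (c : ℝ) :
    F (fiberLeft H c) = fiberLeft H (2 * c) := by
  refine eq_of_forall_ge_iff fun y => ?_
  obtain ⟨z, rfl⟩ := hF.iterate_surjective 1 y
  rw [Function.iterate_one, hF.strictMono.le_iff_le, hH.fiberLeft_le_iff, hH.fiberLeft_le_iff,
    hH.map_apply]
  constructor <;> intro <;> linarith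

theorem apply_fiberRight (hF : IsDegTwoLift F) (hH : IsDoublingFactor F H) (c : ℝ) :
    F (fiberRight H c) = fiberRight H (2 * c) := by
  refine eq_of_forall_le_iff fun y => ?_
  obtain ⟨z, rfl⟩ := hF.iterate_surjective 1 y
  rw [Function.iterate_one, hF.strictMono.le_iff_le, hH.le_fiberRight_iff, hH.le_fiberRight_iff,
    hH.map_apply]
  constructor <;> intro <;> linarith

theorem iterate_fiberLeft (hF : IsDegTwoLift F) (hH : IsDoublingFactor F H) (n : ℕ) (c : ℝ) :
    F^[n] (fiberLeft H c) = fiberLeft H (2 ^ n * c) := by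
  induction n with
  | zero => simp
  | succ n ih =>
    rw [Function.iterate_succ_apply', ih, hH.apply_fiberLeft hF, pow_succ', mul_assoc]

theorem iterate_fiberRight (hF : IsDegTwoLift F) (hH : IsDoublingFactor F H) (n : ℕ) (c : ℝ) :
    F^[n] (fiberRight H c) = fiberRight H (2 ^ n * c) := by
  induction n with
  | zero => simp
  | succ n ih =>
    rw [Function.iterate_succ_apply', ih, hH.apply_fiberRight hF, pow_succ', mul_assoc]

theorem exists_fiberLeft_sub_lt (hH : IsDoublingFactor F H) (c : ℝ) {ε : ℝ} (hε : 0 < ε) :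
    ∃ κ > 0, fiberLeft H c - fiberLeft H (c - κ) < ε := by
  have h : H (fiberLeft H c - ε / 2) < c := hH.lt_fiberLeft_iff.1 (by linarith)
  refine ⟨(c - H (fiberLeft H c - ε / 2)) / 2, by linarith, ?_⟩
  have h2 : fiberLeft H c - ε / 2 < fiberLeft H (c - (c - H (fiberLeft H c - ε / 2)) / 2) :=
    hH.lt_fiberLeft_iff.2 (by linarith)
  linarith

theorem exists_fiberLeft_add_lt (hH : IsDoublingFactor F H) (c : ℝ) {ε : ℝ} (hε : 0 < ε) :
    ∃ κ > 0, fiberLeft H (c + κ) < fiberRight H c + ε := by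
  have h : c < H (fiberRight H c + ε / 2) := hH.fiberRight_lt_iff.1 (by linarith)
  refine ⟨H (fiberRight H c + ε / 2) - c, by linarith, ?_⟩
  have h2 : fiberLeft H (c + (H (fiberRight H c + ε / 2) - c)) ≤ fiberRight H c + ε / 2 :=
    hH.fiberLeft_le_iff.2 (by linarith)
  linarith

end IsDoublingFactor

theorem sum_length_le_two_of_disjoint_translates {t : ℕ} {l r : ℕ → ℝ}
    (hlr : ∀ i < t, l i ≤ r i) (hle : ∀ i < t, r i ≤ l i + 1)
    (hdisj : ∀ i j, i < j → j < t → ∀ m : ℤ, r i ≤ l j + m ∨ r j + m ≤ l i) :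
    ∑ i ∈ Finset.range t, (r i - l i) ≤ 2 := by
  have hpd : (Finset.range t : Set ℕ).PairwiseDisjoint
      fun i => Ico (l i - ⌊l i⌋) (r i - ⌊l i⌋) := by
    have key : ∀ i j, i < j → j < t →
        Disjoint (Ico (l i - ⌊l i⌋) (r i - ⌊l i⌋)) (Ico (l j - ⌊l j⌋) (r j - ⌊l j⌋)) := by
      intro i j hij hj
      rw [Set.disjoint_left]
      rintro z ⟨h1, h2⟩ ⟨h3, h4⟩
      have := hdisj i j hij hj (⌊l i⌋ - ⌊l j⌋)
      push_cast at this
      rcases this with h | h <;> linarith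
    intro i hi j hj hij
    simp only [Finset.coe_range, mem_Iio] at hi hj
    rcases lt_or_gt_of_ne hij with h | h
    · exact key i j h hj
    · exact (key j i h hi).symm
  have hvol : volume (⋃ i ∈ Finset.range t, Ico (l i - ⌊l i⌋) (r i - ⌊l i⌋))
      ≤ volume (Icc (0 : ℝ) 2) := by
    refine measure_mono (iUnion₂_subset fun i hi z hz => ?_)
    have hit := Finset.mem_range.1 hi
    have h1 := Int.floor_le (l i)
    have h2 := Int.lt_floor_add_one (l i)
    have h3 := hle i hit
    exact ⟨by linarith [hz.1], by linarith [hz.2]⟩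
  rw [measure_biUnion_finset hpd fun _ _ => measurableSet_Ico] at hvol
  simp only [Real.volume_Ico, Real.volume_Icc, sub_sub_sub_cancel_right, sub_zero] at hvol
  rw [← ENNReal.ofReal_sum_of_nonneg
    fun i hi => sub_nonneg.2 (hlr i (Finset.mem_range.1 hi))] at hvol
  exact (ENNReal.ofReal_le_ofReal_iff zero_le_two).1 hvol

/-- The derivative of `F^[n]`, written as a product along the orbit. -/
def orbitDeriv (F : ℝ → ℝ) (n : ℕ) (y : ℝ) : ℝ := ∏ i ∈ Finset.range n, deriv F (F^[i] y)

theorem hasDerivAt_iterate_orbitDeriv {F : ℝ → ℝ} (hd : Differentiable ℝ F) (n : ℕ) (y : ℝ) :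
    HasDerivAt F^[n] (orbitDeriv F n y) y := by
  induction n with
  | zero => simpa [orbitDeriv] using hasDerivAt_id y
  | succ n ih =>
    rw [Function.iterate_succ', orbitDeriv, Finset.prod_range_succ, mul_comm]
    exact (hd _).hasDerivAt.comp y ih

theorem orbitDeriv_pos {F : ℝ → ℝ} (hpos : ∀ x, 0 < deriv F x) (n : ℕ) (y : ℝ) :
    0 < orbitDeriv F n y := Finset.prod_pos fun _ _ => hpos _

theorem orbitDeriv_add (F : ℝ → ℝ) (n t : ℕ) (y : ℝ) :
    orbitDeriv F (n + t) y = orbitDeriv F n y * orbitDeriv F t (F^[n] y) := by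
  rw [orbitDeriv, Finset.prod_range_add, orbitDeriv, orbitDeriv]
  simp only [← Function.iterate_add_apply, add_comm]

theorem exists_orbitDeriv_eq {F : ℝ → ℝ} (hd : Differentiable ℝ F) (n : ℕ) {p q : ℝ} (h : p < q) :
    ∃ ξ ∈ Icc p q, F^[n] q - F^[n] p = orbitDeriv F n ξ * (q - p) := by
  obtain ⟨ξ, hξ, h1⟩ := exists_hasDerivAt_eq_slope F^[n] (orbitDeriv F n) h
    (fun z _ => (hasDerivAt_iterate_orbitDeriv hd n z).continuousAt.continuousWithinAt)
    fun z _ => hasDerivAt_iterate_orbitDeriv hd n z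
  exact ⟨ξ, Ioo_subset_Icc_self hξ, by rw [h1, div_mul_cancel₀ _ (by linarith)]⟩

theorem IsDegTwoLift.deriv_periodic {F : ℝ → ℝ} (hF : IsDegTwoLift F) :
    Function.Periodic (deriv F) 1 := fun x => by
  rw [← deriv_comp_add_const]
  simp only [hF.map_add_one, deriv_add_const']

theorem IsDegTwoLift.orbitDeriv_add_int {F : ℝ → ℝ} (hF : IsDegTwoLift F) (n : ℕ) (y : ℝ) (m : ℤ) :
    orbitDeriv F n (y + m) = orbitDeriv F n y := by
  refine Finset.prod_congr rfl fun i _ => ?_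
  rw [hF.iterate_add_int]
  have := hF.deriv_periodic.int_mul (2 ^ i * m) (F^[i] y)
  push_cast at this
  rwa [mul_one] at this

theorem IsDegTwoLift.exists_lipschitz_log_deriv {F : ℝ → ℝ} (hF : IsDegTwoLift F)
    (hC2 : ContDiff ℝ 2 F) (hpos : ∀ x, 0 < deriv F x) :
    ∃ C, 0 ≤ C ∧ ∀ y z, |Real.log (deriv F y) - Real.log (deriv F z)| ≤ C * |y - z| := by
  have hd1 : ContDiff ℝ 1 (deriv F) := ((contDiff_succ_iff_deriv (n := 1)).1 hC2).2.2
  have hlog : ContDiff ℝ 1 fun y => Real.log (deriv F y) := hd1.log fun x => (hpos x).ne'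
  have hper : Function.Periodic (deriv fun y => Real.log (deriv F y)) 1 := fun x => by
    rw [← deriv_comp_add_const]
    simp only [hF.deriv_periodic _]
  obtain ⟨C, hC⟩ := isCompact_Icc.exists_bound_of_continuousOn (s := Icc (0 : ℝ) 1)
    (hlog.continuous_deriv le_rfl).continuousOn
  have hbound : ∀ y, ‖deriv (fun y => Real.log (deriv F y)) y‖ ≤ C := fun y => by
    obtain ⟨z, hz, hyz⟩ := hper.exists_mem_Ico₀ one_pos y
    rw [hyz]
    exact hC z (Ico_subset_Icc_self hz)
  refine ⟨C, (norm_nonneg _).trans (hbound 0), fun y z => ?_⟩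
  exact convex_univ.norm_image_sub_le_of_norm_deriv_le
    (fun x _ => (hlog.differentiable one_ne_zero) x) (fun x _ => hbound x) (mem_univ z)
    (mem_univ y)

/-- `K` bounds the distortion of `F^[t]` along every interval whose first `t` iterates are
disjoint modulo one. -/
def IsDistortionBound (F : ℝ → ℝ) (K : ℝ) : Prop :=
  ∀ (t : ℕ) (l r : ℝ), l ≤ r → (∀ i < t, F^[i] r ≤ F^[i] l + 1) →
    (∀ i j, i < j → j < t → ∀ m : ℤ, F^[i] r ≤ F^[j] l + m ∨ F^[j] r + m ≤ F^[i] l) →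
    ∀ y ∈ Icc l r, ∀ z ∈ Icc l r, orbitDeriv F t y ≤ K * orbitDeriv F t z

/-- Denjoy's distortion bound. -/
theorem IsDegTwoLift.exists_distortion {F : ℝ → ℝ} (hF : IsDegTwoLift F) (hC2 : ContDiff ℝ 2 F)
    (hpos : ∀ x, 0 < deriv F x) :
    ∃ K, 1 ≤ K ∧ IsDistortionBound F K := by
  obtain ⟨C, hC0, hC⟩ := hF.exists_lipschitz_log_deriv hC2 hpos
  refine ⟨Real.exp (C * 2), Real.one_le_exp (by positivity), fun t l r hlr hle hdisj y hy z hz => ?_⟩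
  have hmono := fun i => (hF.iterate_strictMono i).monotone
  have hsum := sum_length_le_two_of_disjoint_translates (t := t) (l := fun i => F^[i] l)
    (r := fun i => F^[i] r) (fun i _ => hmono i hlr) hle hdisj
  have hlogD : ∀ w, Real.log (orbitDeriv F t w)
      = ∑ i ∈ Finset.range t, Real.log (deriv F (F^[i] w)) := fun w =>
    Real.log_prod fun i _ => (hpos _).ne'
  have h1 : Real.log (orbitDeriv F t y) - Real.log (orbitDeriv F t z) ≤ C * 2 := by
    rw [hlogD, hlogD, ← Finset.sum_sub_distrib]
    calc _ ≤ ∑ i ∈ Finset.range t, C * (F^[i] r - F^[i] l) := by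
          refine Finset.sum_le_sum fun i _ => (le_abs_self _).trans ((hC _ _).trans ?_)
          refine mul_le_mul_of_nonneg_left ?_ hC0
          rw [abs_sub_le_iff]
          constructor <;>
            linarith [hmono i hy.1, hmono i hy.2, hmono i hz.1, hmono i hz.2]
      _ = C * ∑ i ∈ Finset.range t, (F^[i] r - F^[i] l) := by rw [Finset.mul_sum]
      _ ≤ C * 2 := mul_le_mul_of_nonneg_left hsum hC0
  have hy0 := orbitDeriv_pos hpos t y
  have hz0 := orbitDeriv_pos hpos t z
  rw [← Real.exp_log hy0, ← Real.exp_log hz0, ← Real.exp_add, Real.exp_le_exp]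
  linarith

section Branch
variable {F H : ℝ → ℝ} {K α β : ℝ}

theorem IsDistortionBound.firstReturn (hK : IsDistortionBound F K) (hF : IsDegTwoLift F)
    (hH : IsDoublingFactor F H) (hnice : DoublingNice α β) (hβ : β ≤ α + 1)
    {a b y : ℝ} {t : ℕ} {k : ℤ} (ha : 2 ^ t * a = α + k) (hb : 2 ^ t * b = β + k)
    (hay : a < y) (hyb : y < b)
    (hfirst : ∀ t', 0 < t' → t' < t → ∀ m : ℤ, ¬ (α < 2 ^ t' * y - m ∧ 2 ^ t' * y - m < β)) :
    ∀ p ∈ Icc (fiberLeft H a) (fiberLeft H b), ∀ q ∈ Icc (fiberLeft H a) (fiberLeft H b),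
      orbitDeriv F t p ≤ K * orbitDeriv F t q := by
  have hs := hH.fiberLeft_strictMono.monotone
  refine hK t _ _ (hs (by linarith)) (fun i hi => ?_) fun i j hij hj m => ?_
  · rw [hH.iterate_fiberLeft hF, hH.iterate_fiberLeft hF]
    have := hH.fiberLeft_add_int (2 ^ i * a) 1
    push_cast at this
    rw [← this]
    refine hs ?_
    obtain ⟨e, rfl⟩ : ∃ e, t = e + i := ⟨t - i, by omega⟩
    have hp : (1 : ℝ) ≤ 2 ^ e := one_le_pow₀ (by norm_num)
    rw [pow_add] at ha hb
    have h3 : (2 : ℝ) ^ e * (2 ^ i * b - 2 ^ i * a) ≤ 1 := by linarith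
    have h4 : 0 ≤ (2 : ℝ) ^ i * b - 2 ^ i * a := by
      rw [← mul_sub]; exact mul_nonneg (by positivity) (by linarith)
    nlinarith
  · simp only [hH.iterate_fiberLeft hF, ← hH.fiberLeft_add_int]
    exact (hnice.firstReturn_disjoint ha hb hay hyb hfirst hij hj m).imp (hs ·) (hs ·)

/-- If the orbit of `H x` returns infinitely often to a nice interval and the branches of the first
return map along this orbit eventually have short domains, then the derivatives of the iterates of
`F` at `x` are not bounded by one. -/
theorem IsDistortionBound.exists_one_lt_orbitDeriv (hK : IsDistortionBound F K) (hK0 : 0 < K)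
    (hd : Differentiable ℝ F) (hpos : ∀ x, 0 < deriv F x) (hF : IsDegTwoLift F)
    (hH : IsDoublingFactor F H) (hnice : DoublingNice α β) (hβ : β ≤ α + 1) {x : ℝ}
    (hio : ∀ N : ℕ, ∃ n ≥ N, ∃ m : ℤ, α < 2 ^ n * H x - m ∧ 2 ^ n * H x - m < β) {N : ℕ}
    (hshort : ∀ n ≥ N, ∀ t ≥ 1, ∀ (m k : ℤ) (y a b : ℝ), y = 2 ^ n * H x - m → α < y → y < β →
      2 ^ t * a = α + k → 2 ^ t * b = β + k → a < y → y < b →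
      (∀ t', 0 < t' → t' < t → ∀ m' : ℤ, ¬ (α < 2 ^ t' * y - m' ∧ 2 ^ t' * y - m' < β)) →
      fiberLeft H b - fiberLeft H a ≤ (fiberLeft H β - fiberLeft H α) / (2 * K)) :
    ∃ n, 1 < orbitDeriv F n x := by
  classical
  have hstep : ∀ n ≥ N, (∃ m : ℤ, α < 2 ^ n * H x - m ∧ 2 ^ n * H x - m < β) →
      ∃ n' ≥ N, (∃ m : ℤ, α < 2 ^ n' * H x - m ∧ 2 ^ n' * H x - m < β) ∧
        2 * orbitDeriv F n x ≤ orbitDeriv F n' x := by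
    rintro n hn ⟨m, hm1, hm2⟩
    set y := 2 ^ n * H x - m with hy
    have hshift : ∀ (t : ℕ) (k : ℤ),
        2 ^ t * y - k = 2 ^ (n + t) * H x - ((k + 2 ^ t * m : ℤ) : ℝ) := by
      intro t k; rw [hy]; push_cast; ring
    have hex : ∃ t, 0 < t ∧ ∃ k : ℤ, α < 2 ^ t * y - k ∧ 2 ^ t * y - k < β := by
      obtain ⟨n', hn', k, hk⟩ := hio (n + 1)
      obtain ⟨e, rfl⟩ : ∃ e, n' = n + e := ⟨n' - n, by omega⟩
      refine ⟨e, by omega, k - 2 ^ e * m, ?_⟩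
      rw [hshift]
      simpa using hk
    obtain ⟨ht, k, hk1, hk2⟩ := Nat.find_spec hex
    set t := Nat.find hex
    have hfirst : ∀ t', 0 < t' → t' < t → ∀ m' : ℤ,
        ¬ (α < 2 ^ t' * y - m' ∧ 2 ^ t' * y - m' < β) := fun t' h1 h2 m' h3 =>
      Nat.find_min hex h2 ⟨h1, m', h3⟩
    have hp : (0 : ℝ) < 2 ^ t := by positivity
    have ha : 2 ^ t * ((α + k) / 2 ^ t) = α + k := mul_div_cancel₀ _ hp.ne'
    have hb : 2 ^ t * ((β + k) / 2 ^ t) = β + k := mul_div_cancel₀ _ hp.ne'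
    have hay : (α + k) / 2 ^ t < y := by rw [div_lt_iff₀ hp]; linarith
    have hyb : y < (β + k) / 2 ^ t := by rw [lt_div_iff₀ hp]; linarith
    have hle := hshort n hn t ht m k y _ _ hy hm1 hm2 ha hb hay hyb hfirst
    have hdist := hK.firstReturn hF hH hnice hβ ha hb hay hyb hfirst
    set a := (α + k) / 2 ^ t
    set b := (β + k) / 2 ^ t
    have hab : fiberLeft H a < fiberLeft H b := hH.fiberLeft_strictMono (hay.trans hyb)
    obtain ⟨ξ, hξ, hmv⟩ := exists_orbitDeriv_eq hd t hab
    rw [hH.iterate_fiberLeft hF, hH.iterate_fiberLeft hF, ha, hb, hH.fiberLeft_add_int,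
      hH.fiberLeft_add_int, add_sub_add_right_eq_sub] at hmv
    have hyH : H (F^[n] x + ((-m : ℤ) : ℝ)) = y := by
      rw [hH.map_add_int, hH.map_iterate, hy]; push_cast; ring
    have hmem : F^[n] x + ((-m : ℤ) : ℝ) ∈ Icc (fiberLeft H a) (fiberLeft H b) :=
      ⟨hH.fiberLeft_le_iff.2 (hyH ▸ hay.le), (hH.lt_fiberLeft_iff.2 (hyH ▸ hyb)).le⟩
    have h1 := hdist ξ hξ _ hmem
    rw [hF.orbitDeriv_add_int] at h1
    refine ⟨n + t, by omega, ⟨k + 2 ^ t * m, by rw [← hshift]; exact ⟨hk1, hk2⟩⟩, ?_⟩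
    rw [orbitDeriv_add]
    have h2 : 2 ≤ orbitDeriv F t (F^[n] x) := by
      rw [le_div_iff₀ (by positivity), hmv] at hle
      have h3 : 0 < fiberLeft H b - fiberLeft H a := by linarith
      have h4 : 2 * K ≤ orbitDeriv F t ξ := by
        by_contra! h
        have := mul_lt_mul_of_pos_right h h3
        linarith
      have h5 : K * 2 ≤ K * orbitDeriv F t (F^[n] x) := by linarith
      exact le_of_mul_le_mul_left h5 hK0
    have := orbitDeriv_pos hpos n x
    nlinarith
  obtain ⟨n₀, hn₀, hm₀⟩ := hio N
  have hiter : ∀ j : ℕ, ∃ n ≥ N, (∃ m : ℤ, α < 2 ^ n * H x - m ∧ 2 ^ n * H x - m < β) ∧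
      2 ^ j * orbitDeriv F n₀ x ≤ orbitDeriv F n x := by
    intro j
    induction j with
    | zero => exact ⟨n₀, hn₀, hm₀, by simp⟩
    | succ j ih =>
      obtain ⟨n, hn, hm, hle⟩ := ih
      obtain ⟨n', hn', hm', hle'⟩ := hstep n hn hm
      exact ⟨n', hn', hm', by rw [pow_succ']; linarith⟩
  have hD := orbitDeriv_pos hpos n₀ x
  obtain ⟨j, hj⟩ := pow_unbounded_of_one_lt (1 / orbitDeriv F n₀ x) one_lt_two
  obtain ⟨n, -, -, hn⟩ := hiter j
  rw [div_lt_iff₀ hD] at hj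
  exact ⟨n, by linarith⟩

end Branch

theorem exists_dist_int_pos {z : ℝ} (hz : ∀ m : ℤ, z ≠ m) : ∃ η > 0, ∀ m : ℤ, η ≤ |z - m| := by
  have h := Int.isClosedEmbedding_coe_real.isClosed_range.isOpen_compl
  obtain ⟨η, hη, hball⟩ := Metric.isOpen_iff.1 h z (by rintro ⟨m, hm⟩; exact hz m hm.symm)
  refine ⟨η, hη, fun m => ?_⟩
  by_contra! hlt
  have hm : (m : ℝ) ∈ Metric.ball z η := by rwa [Metric.mem_ball, dist_comm, Real.dist_eq]
  exact hball hm ⟨m, rfl⟩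

theorem exists_return_gap {ζ : ℝ} (hζ : ¬ DoublingPeriodic ζ) (T : ℕ) :
    ∃ η > 0, ∀ t, 1 ≤ t → t ≤ T → ∀ m : ℤ, η ≤ |2 ^ t * ζ - m - ζ| := by
  induction T with
  | zero => exact ⟨1, one_pos, fun t h1 h2 => by omega⟩
  | succ T ih =>
    obtain ⟨η, hη, h⟩ := ih
    obtain ⟨η', hη', h'⟩ := exists_dist_int_pos (z := 2 ^ (T + 1) * ζ - ζ)
      fun m hm => hζ ⟨T + 1, by omega, m, by linarith⟩
    refine ⟨min η η', lt_min hη hη', fun t h1 h2 m => ?_⟩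
    rcases Nat.lt_or_ge T t with h3 | h3
    · obtain rfl : t = T + 1 := by omega
      rw [sub_right_comm]
      exact (min_le_right _ _).trans (h' m)
    · exact (min_le_left _ _).trans (h t h1 h3 m)

theorem exists_one_div_two_pow_lt {κ : ℝ} (hκ : 0 < κ) : ∃ n : ℕ, 1 / 2 ^ n < κ := by
  obtain ⟨n, hn⟩ := exists_pow_lt_of_lt_one hκ (show (1 / 2 : ℝ) < 1 by norm_num)
  exact ⟨n, by rwa [one_div_pow] at hn⟩

theorem one_div_two_pow_le_of_le {m n : ℕ} (h : m ≤ n) : (1 : ℝ) / 2 ^ n ≤ 1 / 2 ^ m :=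
  one_div_le_one_div_of_le (by positivity) (pow_le_pow_right₀ one_le_two h)

theorem IsOmegaPt.frequently_mem_Ioo {θ ζ α β : ℝ} (h : IsOmegaPt θ ζ) (hα : α < ζ) (hβ : ζ < β)
    (N : ℕ) : ∃ n ≥ N, ∃ m : ℤ, α < 2 ^ n * θ - m ∧ 2 ^ n * θ - m < β := by
  obtain ⟨n, hn, m, hm⟩ := h (min (ζ - α) (β - ζ)) (lt_min (by linarith) (by linarith)) N
  obtain ⟨h1, h2⟩ := abs_lt.1 hm
  have h3 := min_le_left (ζ - α) (β - ζ)
  have h4 := min_le_right (ζ - α) (β - ζ)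
  exact ⟨n, hn, m, by linarith, by linarith⟩

section
variable {F H : ℝ → ℝ} {K ζ x : ℝ}

theorem IsDistortionBound.exists_one_lt_orbitDeriv_of_fiber (hK : IsDistortionBound F K)
    (hK0 : 0 < K) (hd : Differentiable ℝ F) (hpos : ∀ x, 0 < deriv F x) (hF : IsDegTwoLift F)
    (hH : IsDoublingFactor F H) (hω : IsOmegaPt (H x) ζ) (hζ : ¬ DoublingPeriodic ζ)
    (hfib : fiberLeft H ζ < fiberRight H ζ) : ∃ n, 1 < orbitDeriv F n x := by
  set ε := (fiberRight H ζ - fiberLeft H ζ) / (2 * K) with hε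
  have hε0 : 0 < ε := div_pos (by linarith) (by positivity)
  have hKε : 2 * K * ε = fiberRight H ζ - fiberLeft H ζ := by rw [hε]; field_simp
  obtain ⟨κ₁, hκ₁, hl⟩ := hH.exists_fiberLeft_sub_lt ζ hε0
  obtain ⟨κ₂, hκ₂, hr⟩ := hH.exists_fiberLeft_add_lt ζ hε0
  obtain ⟨n', hn'⟩ := exists_one_div_two_pow_lt (lt_min hκ₁ hκ₂)
  set n := n' + 1 with hn
  have h2 : (1 : ℝ) / 2 ^ n = 1 / 2 ^ n' / 2 := by rw [hn, pow_succ]; field_simp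
  have h3 := one_div_two_pow_le_of_le (Nat.zero_le n')
  have h3' : (0 : ℝ) < 1 / 2 ^ n' := by positivity
  have h4 := min_le_left κ₁ κ₂
  have h5 := min_le_right κ₁ κ₂
  rw [pow_zero] at h3
  obtain ⟨u, v, huv, hnice⟩ := exists_nice_neighborhoods ζ
  replace hnice := hnice n n le_rfl fun r h1 h2 => by omega
  obtain ⟨hu, hv, hud, hvd⟩ := huv n
  set α := u n
  set β := v n
  have hs := hH.fiberLeft_strictMono
  have hsα : fiberLeft H ζ - fiberLeft H α < ε := by
    have := hs.monotone (show ζ - κ₁ ≤ α by linarith)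
    linarith
  have hsβ : fiberLeft H β - fiberRight H ζ < ε := by
    have := hs.monotone (show β ≤ ζ + κ₂ by linarith)
    linarith
  have hαζ := hs hu
  have hζβ := hH.fiberRight_lt_fiberLeft hv
  have hεle : ε ≤ (fiberLeft H β - fiberLeft H α) / (2 * K) := by
    rw [hε]; gcongr
  refine hK.exists_one_lt_orbitDeriv hK0 hd hpos hF hH hnice (by linarith)
    (hω.frequently_mem_Ioo hu hv) (N := 0) ?_
  intro i _ t ht m k y a b hy hαy hyβ ha hb hay hyb hfirst
  refine le_trans ?_ hεle
  obtain ⟨hαa, hbβ⟩ := hnice.pullback_subset (m := 0) ht ha hb (by simpa using hαy.trans hyb)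
    (by simpa using hay.trans hyβ)
  simp only [Int.cast_zero, add_zero] at hαa hbβ
  have hsa := hs.monotone hαa
  have hsb := hs.monotone hbβ
  rcases le_or_gt b ζ with hbζ | hζb
  · have := hs.monotone hbζ
    linarith
  rcases lt_or_ge ζ a with hζa | haζ
  · have := hH.fiberRight_lt_fiberLeft hζa
    linarith
  exfalso
  obtain ⟨c, hc⟩ : ∃ c, c = 2 ^ t * ζ - k := ⟨_, rfl⟩
  have hp : (0 : ℝ) < 2 ^ t := by positivity
  have hαc : α ≤ c := by
    have := mul_le_mul_of_nonneg_left haζ hp.le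
    linarith
  have hcβ : c < β := by
    have := mul_lt_mul_of_pos_left hζb hp
    linarith
  have hcfib : fiberRight H c - fiberLeft H c < ε := by
    rcases lt_trichotomy c ζ with h | h | h
    · have h6 := hH.fiberRight_lt_fiberLeft h
      have h7 := hs.monotone hαc
      linarith
    · exact absurd ⟨t, ht, k, by linarith⟩ hζ
    · have h6 := hH.fiberRight_lt_fiberLeft h
      have h7 := hH.fiberRight_lt_fiberLeft hcβ
      linarith
  have hdist := hK.firstReturn hF hH hnice (by linarith) ha hb hay hyb hfirst
  have hab := hs (hay.trans hyb)
  have haζ' := hs.monotone haζ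
  have hζb' := hH.fiberRight_lt_fiberLeft hζb
  obtain ⟨ξ, hξ, hξ'⟩ := exists_orbitDeriv_eq hd t hfib
  obtain ⟨η, hη, hη'⟩ := exists_orbitDeriv_eq hd t hab
  have hck : 2 ^ t * ζ = c + k := by linarith
  rw [hH.iterate_fiberLeft hF, hH.iterate_fiberRight hF, hck, hH.fiberLeft_add_int,
    hH.fiberRight_add_int, add_sub_add_right_eq_sub] at hξ'
  rw [hH.iterate_fiberLeft hF, hH.iterate_fiberLeft hF, ha, hb, hH.fiberLeft_add_int,
      hH.fiberLeft_add_int, add_sub_add_right_eq_sub] at hη'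
  have h6 := hdist η hη ξ ⟨by linarith [hξ.1], by linarith [hξ.2]⟩
  have h7 : 1 ≤ orbitDeriv F t η := by
    by_contra! h
    have := mul_lt_mul_of_pos_right h (sub_pos.2 hab)
    linarith
  have h8 : 1 * (fiberRight H ζ - fiberLeft H ζ)
      ≤ K * orbitDeriv F t ξ * (fiberRight H ζ - fiberLeft H ζ) := by
    have := sub_pos.2 hfib
    gcongr
    linarith
  rw [mul_assoc, ← hξ'] at h8
  have h9 := mul_lt_mul_of_pos_left hcfib hK0
  nlinarith

theorem IsDistortionBound.exists_one_lt_orbitDeriv_of_leftIsolated (hK : IsDistortionBound F K)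
    (hK0 : 0 < K) (hd : Differentiable ℝ F) (hpos : ∀ x, 0 < deriv F x) (hF : IsDegTwoLift F)
    (hH : IsDoublingFactor F H) (hω : IsOmegaPt (H x) ζ) (hζ : ¬ DoublingPeriodic ζ)
    (hfib : fiberRight H ζ ≤ fiberLeft H ζ) {z : ℝ} (hz : z < ζ)
    (hgap : ∀ c, z < c → c < ζ → ¬ IsOmegaPt (H x) c) : ∃ n, 1 < orbitDeriv F n x := by
  obtain ⟨u, v, huv, hnice⟩ := exists_nice_neighborhoods ζ
  obtain ⟨n₁, hn₁⟩ := exists_one_div_two_pow_lt (sub_pos.2 hz)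
  set n₀ := n₁ + 1 with hn₀
  obtain ⟨hu, -, hud, -⟩ := huv n₀
  have hzu : z < u n₀ := by
    have := one_div_two_pow_le_of_le (show n₁ ≤ n₀ by omega)
    linarith
  set α := u n₀
  have hs := hH.fiberLeft_strictMono
  have hαζ := hs hu
  set ε := (fiberLeft H ζ - fiberLeft H α) / (2 * K) with hε
  have hε0 : 0 < ε := div_pos (by linarith) (by positivity)
  obtain ⟨κ₁, hκ₁, hl⟩ := hH.exists_fiberLeft_sub_lt ζ (half_pos hε0)
  obtain ⟨κ₂, hκ₂, hr⟩ := hH.exists_fiberLeft_add_lt ζ (half_pos hε0)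
  obtain ⟨κ, hκ, hκκ₁, hκκ₂⟩ : ∃ κ > 0, 2 * κ ≤ κ₁ ∧ 2 * κ ≤ κ₂ :=
    ⟨min κ₁ κ₂ / 2, half_pos (lt_min hκ₁ hκ₂), by linarith [min_le_left κ₁ κ₂],
      by linarith [min_le_right κ₁ κ₂]⟩
  obtain ⟨T, hT⟩ := exists_one_div_two_pow_lt hκ
  obtain ⟨η, hη, hret⟩ := exists_return_gap hζ T
  obtain ⟨κ', hκ', hκ'κ, hκ'η⟩ : ∃ κ' > 0, κ' ≤ κ ∧ (2 ^ T + 1) * κ' ≤ η := by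
    refine ⟨min κ (η / (2 ^ T + 1)), lt_min hκ (by positivity), min_le_left _ _, ?_⟩
    rw [mul_comm, ← le_div_iff₀ (by positivity)]
    exact min_le_right _ _
  obtain ⟨n₂, hn₂⟩ := exists_one_div_two_pow_lt hκ'
  set n := max n₀ n₂ with hn
  obtain ⟨-, hv, -, hvd⟩ := huv n
  replace hnice := hnice n₀ n (le_max_left _ _) fun r _ _ m h =>
    hgap _ (hzu.trans h.1) h.2 ((hω.pow_mul r).sub_int m)
  set β := v n
  have hβκ : β < ζ + κ' := by
    have := one_div_two_pow_le_of_le (show n₂ ≤ n from le_max_right _ _)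
    linarith
  have hβα : β ≤ α + 1 := by
    have h1 := one_div_two_pow_le_of_le (show n₀ ≤ n from le_max_left _ _)
    have h2 := one_div_two_pow_le_of_le (show 1 ≤ n₀ by omega)
    rw [pow_one] at h2
    linarith
  obtain ⟨N, hN⟩ : ∃ N : ℕ, ∀ i ≥ N, ∀ m : ℤ, 2 ^ i * H x - m ∉ Icc α (ζ - κ') := by
    by_contra! hcon
    obtain ⟨c, hc, hcω⟩ := exists_isOmegaPt_of_frequently hcon
    exact hgap c (by linarith [hc.1]) (by linarith [hc.2]) hcω
  have hεle : ε ≤ (fiberLeft H β - fiberLeft H α) / (2 * K) := by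
    have := hs hv
    rw [hε]; gcongr
  refine hK.exists_one_lt_orbitDeriv hK0 hd hpos hF hH hnice hβα
    (hω.frequently_mem_Ioo hu hv) (N := N) ?_
  intro i hi t ht m k y a b hy hαy hyβ ha hb hay hyb hfirst
  refine le_trans ?_ hεle
  have hp : (0 : ℝ) < 2 ^ t := by positivity
  have hyκ : ζ - κ' < y := by
    by_contra! h
    exact hN i hi m ⟨by linarith, by linarith⟩
  have hyκ' : 2 ^ t * y - k ∈ Ioo (ζ - κ') (ζ + κ') := by
    have h1 := mul_lt_mul_of_pos_left hay hp
    have h2 := mul_lt_mul_of_pos_left hyb hp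
    refine ⟨?_, by linarith⟩
    by_contra! h
    refine hN (i + t) (by omega) (k + 2 ^ t * m) ?_
    have : 2 ^ (i + t) * H x - ((k + 2 ^ t * m : ℤ) : ℝ) = 2 ^ t * y - k := by
      rw [hy]; push_cast; ring
    rw [this]
    exact ⟨by linarith, h⟩
  have hTt : T ≤ t := by
    by_contra! h
    have h1 := hret t ht h.le k
    have h2 : |2 ^ t * ζ - k - ζ| ≤ 2 ^ t * |ζ - y| + |2 ^ t * y - k - ζ| := by
      have h3 : 2 ^ t * ζ - k - ζ = 2 ^ t * (ζ - y) + (2 ^ t * y - k - ζ) := by ring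
      rw [h3]
      refine (abs_add_le _ _).trans ?_
      rw [abs_mul, abs_of_pos hp]
    have h4 : |ζ - y| < κ' := abs_lt.2 ⟨by linarith, by linarith⟩
    have h5 : |2 ^ t * y - k - ζ| < κ' := abs_lt.2 ⟨by linarith [hyκ'.1], by linarith [hyκ'.2]⟩
    have h6 : (2 : ℝ) ^ t ≤ 2 ^ T := pow_le_pow_right₀ one_le_two h.le
    have h7 := mul_le_mul h6 h4.le (abs_nonneg _) (by positivity)
    linarith
  have hba : b - a ≤ κ := by
    have h1 := one_div_two_pow_le_of_le hTt
    have h2 : (b - a) * 2 ^ t ≤ 1 := by linarith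
    rw [← le_div_iff₀ hp] at h2
    linarith
  have h1 := hs.monotone (show ζ - κ₁ ≤ a by linarith)
  have h2 := hs.monotone (show b ≤ ζ + κ₂ by linarith)
  linarith

/-- A point whose image under `H` is not preperiodic for doubling is expanded by some iterate. -/
theorem exists_one_lt_orbitDeriv_of_not_preperiodic (hC2 : ContDiff ℝ 2 F)
    (hpos : ∀ x, 0 < deriv F x) (hF : IsDegTwoLift F) (hH : IsDoublingFactor F H) {p : ℝ}
    (hp : DoublingPeriodic p) (hpfib : fiberLeft H p < fiberRight H p)
    (hx : ∀ n : ℕ, ¬ DoublingPeriodic (2 ^ n * H x)) : ∃ n, 1 < orbitDeriv F n x := by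
  have hd : Differentiable ℝ F := hC2.differentiable two_ne_zero
  obtain ⟨K, hK1, hK⟩ := hF.exists_distortion hC2 hpos
  have hK0 : 0 < K := by linarith
  by_cases hall : ∀ c, IsOmegaPt (H x) c
  · refine hK.exists_one_lt_orbitDeriv_of_fiber hK0 hd hpos hF hH (hall (p + 1 / 2))
      hp.not_add_half (lt_of_le_of_ne (hH.fiberLeft_le_fiberRight _) fun h => ?_)
    have h1 := congrArg F h
    have h2 : 2 * (p + 1 / 2) = 2 * p + ((1 : ℤ) : ℝ) := by push_cast; ring
    rw [hH.apply_fiberLeft hF, hH.apply_fiberRight hF, h2, hH.fiberLeft_add_int,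
      hH.fiberRight_add_int, ← hH.apply_fiberLeft hF, ← hH.apply_fiberRight hF] at h1
    exact (hF.strictMono hpfib).ne (by linarith)
  · push Not at hall
    obtain ⟨y₀, hy₀⟩ := hall
    obtain ⟨ζ, z, hω, hz, hgap, hζ⟩ := exists_leftIsolated_not_periodic hx hy₀
    rcases lt_or_ge (fiberLeft H ζ) (fiberRight H ζ) with h | h
    · exact hK.exists_one_lt_orbitDeriv_of_fiber hK0 hd hpos hF hH hω hζ h
    · exact hK.exists_one_lt_orbitDeriv_of_leftIsolated hK0 hd hpos hF hH hω hζ h hz hgap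

end

theorem unitAddCircle_coe_eq_coe_iff {x y : ℝ} :
    (x : UnitAddCircle) = y ↔ ∃ m : ℤ, x = y + m := by
  rw [← sub_eq_zero, ← AddCircle.coe_sub, AddCircle.coe_eq_zero_iff]
  constructor
  · rintro ⟨m, hm⟩
    refine ⟨m, ?_⟩
    rw [zsmul_one] at hm
    linarith
  · rintro ⟨m, hm⟩
    refine ⟨m, ?_⟩
    rw [zsmul_one]
    linarith

theorem unitAddCircle_coe_add_int (x : ℝ) (m : ℤ) :
    ((x + m : ℝ) : UnitAddCircle) = x := unitAddCircle_coe_eq_coe_iff.2 ⟨m, rfl⟩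

theorem iterate_coe_of_semiconj {φ : UnitAddCircle → UnitAddCircle} {F : ℝ → ℝ}
    (hφ : ∀ x : ℝ, φ x = (F x : ℝ)) (n : ℕ) (x : ℝ) : φ^[n] x = (F^[n] x : ℝ) := by
  induction n with
  | zero => rfl
  | succ n ih => rw [Function.iterate_succ_apply', ih, hφ, Function.iterate_succ_apply']

section
variable {φ : UnitAddCircle → UnitAddCircle} {F H : ℝ → ℝ}

theorem mem_closedArc_iff {a ℓ x : ℝ} :
    (x : UnitAddCircle) ∈ closedArc a ℓ ↔ ∃ m : ℤ, a + m ≤ x ∧ x ≤ a + ℓ + m := by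
  constructor
  · rintro ⟨y, hy, hyx⟩
    obtain ⟨m, hm⟩ := unitAddCircle_coe_eq_coe_iff.1 hyx
    exact ⟨-m, by push_cast; linarith [hy.1], by push_cast; linarith [hy.2]⟩
  · rintro ⟨m, h1, h2⟩
    refine ⟨x + ((-m : ℤ) : ℝ), ⟨by push_cast; linarith, by push_cast; linarith⟩, ?_⟩
    exact unitAddCircle_coe_add_int _ _

theorem exists_shift_of_mapsTo_closedArc {f : ℝ → ℝ} (hf : Continuous f)
    {a ℓ : ℝ} (hℓ0 : 0 ≤ ℓ) (hℓ : ℓ < 1)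
    (h : ∀ y ∈ Icc a (a + ℓ), (f y : UnitAddCircle) ∈ closedArc a ℓ) :
    ∃ m : ℤ, a + m ≤ f a ∧ f (a + ℓ) ≤ a + ℓ + m := by
  obtain ⟨m, hm1, hm2⟩ := mem_closedArc_iff.1 (h a ⟨le_rfl, by linarith⟩)
  refine ⟨m, hm1, ?_⟩
  by_contra! hlt
  set w := min (f (a + ℓ)) (a + ℓ + m + (1 - ℓ) / 2) with hw
  have hw1 : a + ℓ + m < w := lt_min hlt (by linarith)
  have hw2 : w ≤ a + ℓ + m + (1 - ℓ) / 2 := min_le_right _ _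
  obtain ⟨y, hy, hyw⟩ := intermediate_value_Icc (show a ≤ a + ℓ by linarith) hf.continuousOn
    (show w ∈ Icc (f a) (f (a + ℓ)) from ⟨by linarith, min_le_left _ _⟩)
  obtain ⟨j, hj1, hj2⟩ := mem_closedArc_iff.1 (h y hy)
  rw [hyw] at hj1 hj2
  have h1 : (m : ℝ) < j := by linarith
  have h2 : (j : ℝ) < m + 1 := by linarith
  have h3 : m < j := by exact_mod_cast h1
  have h4 : j < m + 1 := by exact_mod_cast h2
  omega

/-- A periodic interval lies in a fibre of `H` over a periodic point. -/
theorem IsPeriodicInterval.eq_of_closedArc (hφ : ∀ x : ℝ, φ x = (F x : ℝ)) (hF : IsDegTwoLift F)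
    (hH : IsDoublingFactor F H) {s : ℕ} {a ℓ : ℝ} (hℓ0 : 0 < ℓ) (hℓ : ℓ < 1)
    (h : IsPeriodicInterval φ s (closedArc a ℓ)) :
    H (a + ℓ) = H a ∧ DoublingPeriodic (H a) := by
  obtain ⟨hs, -, hbij⟩ := h
  obtain ⟨m, h1, h2⟩ := exists_shift_of_mapsTo_closedArc (hF.iterate_continuous s) hℓ0.le hℓ fun y hy => by
      rw [← iterate_coe_of_semiconj hφ]
      exact hbij.mapsTo ⟨y, hy, rfl⟩
  have h3 := hH.monotone h1
  have h4 := hH.monotone h2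
  rw [hH.map_add_int, hH.map_iterate] at h3 h4
  have h5 := hH.monotone (show a ≤ a + ℓ by linarith)
  have hp : (2 : ℝ) ≤ 2 ^ s := by
    have : (2 : ℝ) ^ 1 ≤ 2 ^ s := pow_le_pow_right₀ one_le_two hs
    simpa using this
  have h6 : H (a + ℓ) = H a := by nlinarith
  rw [h6] at h4
  exact ⟨h6, s, hs, m, by linarith⟩

/-- The nontrivial fibres of `H` over periodic points are maximal periodic intervals. -/
theorem isMaxPeriodicInterval_fiber (hφ : ∀ x : ℝ, φ x = (F x : ℝ)) (hF : IsDegTwoLift F)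
    (hH : IsDoublingFactor F H) {c : ℝ} (hc : DoublingPeriodic c)
    (hfib : fiberLeft H c < fiberRight H c) :
    IsMaxPeriodicInterval φ (closedArc (fiberLeft H c) (fiberRight H c - fiberLeft H c)) := by
  have hlen : fiberRight H c < fiberLeft H c + 1 := by
    have h := hH.fiberRight_lt_fiberLeft (show c < c + ((1 : ℤ) : ℝ) by push_cast; linarith)
    rw [hH.fiberLeft_add_int] at h
    simpa using h
  refine ⟨?_, ?_⟩
  · obtain ⟨s, hs, m, hm⟩ := hc
    have hl : F^[s] (fiberLeft H c) = fiberLeft H c + m := by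
      rw [hH.iterate_fiberLeft hF, hm, hH.fiberLeft_add_int]
    have hr : F^[s] (fiberRight H c) = fiberRight H c + m := by
      rw [hH.iterate_fiberRight hF, hm, hH.fiberRight_add_int]
    have hmono := hF.iterate_strictMono s
    refine ⟨s, hs, ⟨_, _, by linarith, by linarith, rfl⟩, ?_, ?_, ?_⟩
    · rintro _ ⟨y, hy, rfl⟩
      simp only [iterate_coe_of_semiconj hφ, mem_closedArc_iff]
      rw [add_sub_cancel] at hy
      exact ⟨m, by linarith [hmono.monotone hy.1], by linarith [hmono.monotone hy.2]⟩
    · rintro _ ⟨y, hy, rfl⟩ _ ⟨z, hz, rfl⟩ hyz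
      simp only [iterate_coe_of_semiconj hφ] at hyz
      obtain ⟨j, hj⟩ := unitAddCircle_coe_eq_coe_iff.1 hyz
      rw [add_sub_cancel] at hy hz
      have h1 := hmono.monotone hy.1
      have h2 := hmono.monotone hy.2
      have h3 := hmono.monotone hz.1
      have h4 := hmono.monotone hz.2
      have h5 : (-1 : ℝ) < j := by linarith
      have h6 : (j : ℝ) < 1 := by linarith
      have h7 : -1 < j := by exact_mod_cast h5
      have h8 : j < 1 := by exact_mod_cast h6
      obtain rfl : j = 0 := by omega
      have hyz' : y = z := hmono.injective (by simpa using hj)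
      rw [hyz']
    · rintro _ ⟨y, hy, rfl⟩
      rw [add_sub_cancel] at hy
      obtain ⟨z, hz⟩ := hF.iterate_surjective s (y + m)
      refine ⟨z, ⟨z, ?_, rfl⟩, ?_⟩
      · rw [add_sub_cancel]
        exact ⟨hmono.le_iff_le.1 (by linarith [hy.1]), hmono.le_iff_le.1 (by linarith [hy.2])⟩
      · rw [iterate_coe_of_semiconj hφ, hz]
        exact unitAddCircle_coe_add_int _ _
  · rintro J ⟨s, hJ⟩ hsub
    obtain ⟨-, ⟨a, ℓ, hℓ0, hℓ, rfl⟩, -⟩ := id hJ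
    obtain ⟨hHa, -⟩ := hJ.eq_of_closedArc hφ hF hH hℓ0 hℓ
    refine hsub.antisymm ?_
    obtain ⟨j, hj1, hj2⟩ := mem_closedArc_iff.1
      (hsub ⟨fiberLeft H c, ⟨le_rfl, by linarith⟩, rfl⟩)
    have h1 := hH.monotone hj1
    have h2 := hH.monotone hj2
    rw [hH.map_add_int, hH.map_fiberLeft] at h1 h2
    rintro _ ⟨y, hy, rfl⟩
    have h3 := hH.monotone hy.1
    have h4 := hH.monotone hy.2
    refine mem_closedArc_iff.2 ⟨-j, ?_, ?_⟩
    · rw [← hH.fiberLeft_add_int, hH.fiberLeft_le_iff]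
      push_cast; linarith
    · rw [add_sub_cancel, ← hH.fiberRight_add_int, hH.le_fiberRight_iff]
      push_cast; linarith

theorem exists_periodic_fiber_of_nonempty (hφ : ∀ x : ℝ, φ x = (F x : ℝ)) (hF : IsDegTwoLift F)
    (hH : IsDoublingFactor F H) (hne : {I | IsMaxPeriodicInterval φ I}.Nonempty) :
    ∃ p, DoublingPeriodic p ∧ fiberLeft H p < fiberRight H p := by
  obtain ⟨I, ⟨s, hI⟩, -⟩ := hne
  obtain ⟨-, ⟨a, ℓ, hℓ0, hℓ, rfl⟩, -⟩ := id hI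
  obtain ⟨h1, h2⟩ := hI.eq_of_closedArc hφ hF hH hℓ0 hℓ
  have h3 := hH.fiberLeft_le_iff.2 (le_refl (H a))
  have h4 := hH.le_fiberRight_iff.2 h1.le
  exact ⟨H a, h2, by linarith⟩

/-- Above a periodic point, the orbit of a point of `Λ` meets only trivial fibres of `H`. -/
theorem eq_of_mem_lambdaSet_of_periodic (hφ : ∀ x : ℝ, φ x = (F x : ℝ)) (hF : IsDegTwoLift F)
    (hH : IsDoublingFactor F H) {x y : ℝ} {q : ℕ} (hx : (x : UnitAddCircle) ∈ lambdaSet φ)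
    (hper : DoublingPeriodic (H (F^[q] x))) (hy : H y = H (F^[q] x)) : y = F^[q] x := by
  by_contra hne
  set c := H (F^[q] x) with hc
  have h1 := hH.fiberLeft_le_iff.2 hc.le
  have h2 := hH.le_fiberRight_iff.2 hc.ge
  have h3 := hH.fiberLeft_le_iff.2 hy.ge
  have h4 := hH.le_fiberRight_iff.2 hy.le
  have hfib : fiberLeft H c < fiberRight H c := by
    rcases lt_or_gt_of_ne hne with h | h <;> linarith
  refine hx.2 (mem_iUnion.2 ⟨q, mem_iUnion₂.2 ⟨_, isMaxPeriodicInterval_fiber hφ hF hH hper hfib,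
    ?_⟩⟩)
  rw [iterate_coe_of_semiconj hφ]
  exact ⟨F^[q] x, ⟨h1, by linarith⟩, rfl⟩

end

/-- A subdivision of the line, invariant under the unit translation, with `r` pieces per period,
into lifts of dyadic intervals; `n k` is the degree of the piece between `p k` and `p (k + 1)`. -/
structure DyadicSubdivision (F : ℝ → ℝ) (r : ℕ) (p : ℤ → ℝ) (n : ℤ → ℕ) : Prop where
  strictMono : StrictMono p
  add_period : ∀ k, p (k + r) = p k + 1
  degree_periodic : ∀ k, n (k + r) = n k
  exists_int : ∀ k, ∃ i : ℤ, F^[n k] (p k) = i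
  iterate_succ : ∀ k, F^[n k] (p (k + 1)) = F^[n k] (p k) + 1

namespace DyadicSubdivision
variable {F : ℝ → ℝ} {r : ℕ} {p q : ℤ → ℝ} {n m : ℤ → ℕ}

theorem add_mul_period (h : DyadicSubdivision F r p n) (k j : ℤ) : p (k + r * j) = p k + j := by
  induction j using Int.induction_on with
  | zero => simp
  | succ i ih =>
    have := h.add_period (k + r * i)
    rw [show k + r * ((i : ℤ) + 1) = k + r * i + r by ring, this, ih]
    push_cast; ring
  | pred i ih =>
    have := h.add_period (k + r * (-(i : ℤ) - 1))
    rw [show k + r * (-(i : ℤ) - 1) + r = k + r * (-i) by ring, ih] at this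
    push_cast at this ⊢
    linarith

theorem exists_mem_Ico (h : DyadicSubdivision F r p n) (y : ℝ) :
    ∃ k, y ∈ Ico (p k) (p (k + 1)) := by
  have hb : ∀ j : ℤ, p (r * j) = p 0 + j := fun j => by simpa using h.add_mul_period 0 j
  obtain ⟨j, hj⟩ := exists_int_gt (y - p 0)
  obtain ⟨j', hj'⟩ := exists_int_lt (y - p 0)
  obtain ⟨k, hk, hmax⟩ := Int.exists_greatest_of_bdd (P := fun k => p k ≤ y)
    ⟨r * j, fun z hz => by
      by_contra! hlt
      have := h.strictMono hlt
      rw [hb] at this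
      linarith⟩ ⟨r * j', by rw [hb]; linarith⟩
  refine ⟨k, hk, ?_⟩
  by_contra! hlt
  have := hmax (k + 1) hlt
  omega

theorem isDyadic (h : DyadicSubdivision F r p n) (k : ℤ) :
    IsDyadic F (n k) ((fun t : ℝ => (t : UnitAddCircle)) '' Icc (p k) (p (k + 1))) :=
  ⟨p k, p (k + 1), h.strictMono (lt_add_one k), h.exists_int k, h.iterate_succ k, rfl⟩

theorem iUnion_eq_univ (h : DyadicSubdivision F r p n) (hr : 0 < r) :
    ⋃ k : Fin r, (fun t : ℝ => (t : UnitAddCircle)) '' Icc (p (k : ℕ)) (p ((k : ℕ) + 1)) = univ := by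
  refine eq_univ_of_forall fun x => ?_
  obtain ⟨y, rfl⟩ := QuotientAddGroup.mk_surjective x
  obtain ⟨k, hk1, hk2⟩ := h.exists_mem_Ico y
  have hr' : (0 : ℤ) < r := by exact_mod_cast hr
  have hmod := Int.emod_nonneg k hr'.ne'
  have hmod' := Int.emod_lt_of_pos k hr'
  obtain ⟨i, hi⟩ := Int.eq_ofNat_of_zero_le hmod
  have hk : k = i + r * (k / r) := by rw [← hi, Int.emod_add_mul_ediv]
  refine mem_iUnion.2 ⟨⟨i, by omega⟩, y + ((-(k / r) : ℤ) : ℝ), ⟨?_, ?_⟩,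
    unitAddCircle_coe_add_int _ _⟩
  · rw [hk, h.add_mul_period] at hk1
    push_cast
    linarith
  · rw [hk, add_right_comm, h.add_mul_period] at hk2
    push_cast
    linarith

theorem interior_inter_interior (h : DyadicSubdivision F r p n) {k l : Fin r} (hkl : k ≠ l) :
    interior ((fun t : ℝ => (t : UnitAddCircle)) '' Icc (p (k : ℕ)) (p ((k : ℕ) + 1))) ∩
      interior ((fun t : ℝ => (t : UnitAddCircle)) '' Icc (p (l : ℕ)) (p ((l : ℕ) + 1))) = ∅ := by
  refine eq_empty_of_forall_notMem fun z hz => ?_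
  obtain ⟨y, hy, rfl⟩ := interior_subset hz.1
  rw [← closure_Ioo (h.strictMono (lt_add_one _)).ne] at hy
  obtain ⟨w, hw1, hw2⟩ := mem_closure_iff.1 hy _
    (isOpen_interior.preimage (AddCircle.continuous_mk' (1 : ℝ))) hz.2
  obtain ⟨v, hv, hvw⟩ := interior_subset hw1
  obtain ⟨j, rfl⟩ := unitAddCircle_coe_eq_coe_iff.1 hvw
  have h1 : p ((l : ℕ) + r * (-j)) < p ((k : ℕ) + 1) := by
    rw [h.add_mul_period]; push_cast; linarith [hv.1, hw2.2]
  have h2 : p (k : ℕ) < p ((l : ℕ) + 1 + r * (-j)) := by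
    rw [h.add_mul_period]; push_cast; linarith [hv.2, hw2.1]
  rw [h.strictMono.lt_iff_lt] at h1 h2
  have h3 : ((k : ℕ) : ℤ) = (l : ℕ) + r * (-j) := by omega
  have hk := k.2
  have hl := l.2
  refine hkl (Fin.ext ?_)
  rcases lt_trichotomy j 0 with h4 | h4 | h4
  · nlinarith
  · subst h4; simpa using h3
  · nlinarith

/-- The relation that matches the pieces of two subdivisions. -/
def Match (F : ℝ → ℝ) (p q : ℤ → ℝ) (n m : ℤ → ℕ) (y z : ℝ) : Prop :=
  ∃ k, y ∈ Icc (p k) (p (k + 1)) ∧ z ∈ Icc (q k) (q (k + 1)) ∧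
    F^[m k] z - F^[m k] (q k) = F^[n k] y - F^[n k] (p k)

theorem Match.symm {y z : ℝ} (h : Match F p q n m y z) : Match F q p m n z y := by
  obtain ⟨k, h1, h2, h3⟩ := h
  exact ⟨k, h2, h1, h3.symm⟩

theorem exists_match_of_mem (hF : IsDegTwoLift F) (hp : DyadicSubdivision F r p n)
    (hq : DyadicSubdivision F r q m) {k : ℤ} {y : ℝ} (hy : y ∈ Icc (p k) (p (k + 1))) :
    ∃ z ∈ Icc (q k) (q (k + 1)), F^[m k] z - F^[m k] (q k) = F^[n k] y - F^[n k] (p k) := by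
  obtain ⟨z, hz⟩ := hF.iterate_surjective (m k) (F^[m k] (q k) + (F^[n k] y - F^[n k] (p k)))
  have hn := (hF.iterate_strictMono (n k)).monotone
  have hm := hF.iterate_strictMono (m k)
  have h1 := hn hy.1
  have h2 := hn hy.2
  rw [hp.iterate_succ] at h2
  refine ⟨z, ⟨hm.le_iff_le.1 (by linarith), hm.le_iff_le.1 ?_⟩, by linarith⟩
  rw [hq.iterate_succ]
  linarith

theorem Match.lt (hF : IsDegTwoLift F) (hp : DyadicSubdivision F r p n)
    (hq : DyadicSubdivision F r q m) {y z y' z' : ℝ} (h : Match F p q n m y z)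
    (h' : Match F p q n m y' z') (hlt : y < y') : z < z' := by
  obtain ⟨k, hy, hz, he⟩ := h
  obtain ⟨l, hy', hz', he'⟩ := h'
  rcases lt_trichotomy k l with hkl | rfl | hkl
  · have h1 := hq.strictMono.monotone (show k + 1 ≤ l by omega)
    refine lt_of_le_of_ne (hz.2.trans (h1.trans hz'.1)) ?_
    rintro rfl
    have h2 : z = q (k + 1) := le_antisymm hz.2 (h1.trans hz'.1)
    have h3 : z = q l := le_antisymm (hz.2.trans h1) hz'.1
    have h4 : k + 1 = l := hq.strictMono.injective (h2.symm.trans h3)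
    rw [h2, hq.iterate_succ] at he
    rw [h3] at he'
    have h5 : y = p (k + 1) := by
      refine (hF.iterate_strictMono (n k)).injective ?_
      rw [hp.iterate_succ]; linarith
    have h6 : y' = p l := (hF.iterate_strictMono (n l)).injective (by linarith)
    rw [h5, h6, h4] at hlt
    exact lt_irrefl _ hlt
  · have h1 := hF.iterate_strictMono (n k) hlt
    exact (hF.iterate_strictMono (m k)).lt_iff_lt.1 (by linarith)
  · have h1 := hp.strictMono.monotone (show l + 1 ≤ k by omega)
    linarith [hy.1, hy'.2]

theorem Match.add_one (hF : IsDegTwoLift F) (hp : DyadicSubdivision F r p n)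
    (hq : DyadicSubdivision F r q m) {y z : ℝ} (h : Match F p q n m y z) :
    Match F p q n m (y + 1) (z + 1) := by
  obtain ⟨k, hy, hz, he⟩ := h
  have hit : ∀ (i : ℕ) (x : ℝ), F^[i] (x + 1) = F^[i] x + 2 ^ i := fun i x => by
    simpa using hF.iterate_add_int i x 1
  refine ⟨k + r, ?_, ?_, ?_⟩
  · rw [add_right_comm, hp.add_period, hp.add_period]
    exact ⟨by linarith [hy.1], by linarith [hy.2]⟩
  · rw [add_right_comm, hq.add_period, hq.add_period]
    exact ⟨by linarith [hz.1], by linarith [hz.2]⟩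
  · rw [hp.add_period, hq.add_period, hp.degree_periodic, hq.degree_periodic]
    simp only [hit]
    linarith

/-- Two subdivisions with the same number of pieces determine an element of the Thompson group. -/
theorem exists_inThompsonGroup {φ : UnitAddCircle → UnitAddCircle} (hφ : ∀ x : ℝ, φ x = (F x : ℝ))
    (hF : IsDegTwoLift F) (hr : 0 < r) (hp : DyadicSubdivision F r p n)
    (hq : DyadicSubdivision F r q m) :
    ∃ g G, InThompsonGroup φ F g ∧ IsOPLift g G ∧ ∀ k, ∀ y ∈ Icc (p k) (p (k + 1)),
      F^[m k] (G y) - F^[m k] (q k) = F^[n k] y - F^[n k] (p k) := by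
  have htot : ∀ y, ∃ z, Match F p q n m y z := fun y => by
    obtain ⟨k, hk⟩ := hp.exists_mem_Ico y
    obtain ⟨z, hz, h⟩ := exists_match_of_mem hF hp hq (Ico_subset_Icc_self hk)
    exact ⟨z, k, Ico_subset_Icc_self hk, hz, h⟩
  have htot' : ∀ z, ∃ y, Match F p q n m y z := fun z => by
    obtain ⟨k, hk⟩ := hq.exists_mem_Ico z
    obtain ⟨y, hy, h⟩ := exists_match_of_mem hF hq hp (Ico_subset_Icc_self hk)
    exact ⟨y, k, hy, Ico_subset_Icc_self hk, h.symm⟩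
  have huniq : ∀ {y z z'}, Match F p q n m y z → Match F p q n m y z' → z = z' := by
    intro y z z' h h'
    by_contra hne
    rcases lt_or_gt_of_ne hne with hlt | hlt
    · exact lt_irrefl _ (h.symm.lt hF hq hp h'.symm hlt)
    · exact lt_irrefl _ (h'.symm.lt hF hq hp h.symm hlt)
  choose G hG using htot
  have hmono : StrictMono G := fun y y' hlt => (hG y).lt hF hp hq (hG y') hlt
  have hsurj : Function.Surjective G := fun z => by
    obtain ⟨y, hy⟩ := htot' z
    exact ⟨y, huniq (hG y) hy⟩
  have hadd : ∀ y, G (y + 1) = G y + 1 := fun y => huniq (hG _) ((hG y).add_one hF hp hq)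
  have hpiece : ∀ k, ∀ y ∈ Icc (p k) (p (k + 1)), G y ∈ Icc (q k) (q (k + 1)) ∧
      F^[m k] (G y) - F^[m k] (q k) = F^[n k] y - F^[n k] (p k) := by
    intro k y hy
    obtain ⟨z, hz, h⟩ := exists_match_of_mem hF hp hq hy
    rw [huniq (hG y) ⟨k, hy, hz, h⟩]
    exact ⟨hz, h⟩
  have hper : Function.Periodic (fun y => (G y : UnitAddCircle)) 1 := fun y => by
    simp only [hadd]
    simp
  have hlift : IsOPLift hper.lift G :=
    ⟨hmono.monotone.continuous_of_surjective hsurj, hmono, hadd, fun y => hper.lift_coe y⟩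
  refine ⟨hper.lift, G, ⟨⟨G, hlift⟩, r,
    fun k => (fun t : ℝ => (t : UnitAddCircle)) '' Icc (p (k : ℕ)) (p ((k : ℕ) + 1)),
    fun k => (fun t : ℝ => (t : UnitAddCircle)) '' Icc (q (k : ℕ)) (q ((k : ℕ) + 1)),
    fun k => n (k : ℕ), fun k => m (k : ℕ), hr, fun k => hp.isDyadic _, fun k => hq.isDyadic _,
    hp.iUnion_eq_univ hr, hq.iUnion_eq_univ hr, fun k l hkl => hp.interior_inter_interior hkl,
    fun k l hkl => hq.interior_inter_interior hkl, fun k => ?_, fun k => ?_⟩, hlift,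
    fun k y hy => (hpiece k y hy).2⟩
  · refine Subset.antisymm ?_ ?_
    · rintro _ ⟨_, ⟨y, hy, rfl⟩, rfl⟩
      exact ⟨G y, (hpiece _ y hy).1, (hlift.2.2.2 y).symm⟩
    · rintro _ ⟨z, hz, rfl⟩
      obtain ⟨y, hy, h⟩ := exists_match_of_mem hF hq hp hz
      refine ⟨y, ⟨y, hy, rfl⟩, ?_⟩
      simp only [hlift.2.2.2]
      rw [huniq (hG y) ⟨_, hy, hz, h.symm⟩]
  · rintro _ ⟨y, hy, rfl⟩
    have h := (hpiece _ y hy).2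
    obtain ⟨i, hi⟩ := hp.exists_int (k : ℕ)
    obtain ⟨j, hj⟩ := hq.exists_int (k : ℕ)
    simp only [hlift.2.2.2, iterate_coe_of_semiconj hφ]
    refine unitAddCircle_coe_eq_coe_iff.2 ⟨j - i, ?_⟩
    push_cast
    linarith

theorem iterate_eq_int_of_eq_mul (hF : IsDegTwoLift F) {N : ℕ} {E : ℤ → ℝ}
    (hE : ∀ j : ℤ, F^[N] (E j) = j) {l : ℕ} (hl : l ≤ N) {j i : ℤ} (hj : j = 2 ^ (N - l) * i) :
    F^[l] (E j) = i := by
  refine (hF.iterate_strictMono (N - l)).injective ?_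
  rw [← Function.iterate_add_apply, Nat.sub_add_cancel hl, hE, hF.iterate_int, hj]
  push_cast
  ring

/-- Subdivisions whose endpoints are among the preimages `E j` of the integers under `F^[N]`. -/
theorem of_int_sequence (hF : IsDegTwoLift F) {N : ℕ} {E : ℤ → ℝ} (hE : ∀ j : ℤ, F^[N] (E j) = j)
    {τ : ℤ → ℤ} (hn : ∀ k, n k ≤ N) (hdvd : ∀ k, (2 : ℤ) ^ (N - n k) ∣ τ k)
    (hstep : ∀ k, τ (k + 1) = τ k + 2 ^ (N - n k)) (hper : ∀ k, τ (k + r) = τ k + 2 ^ N)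
    (hnper : ∀ k, n (k + r) = n k) : DyadicSubdivision F r (fun k => E (τ k)) n := by
  have hinj := (hF.iterate_strictMono N)
  have hroot : ∀ k {j i : ℤ}, j = 2 ^ (N - n k) * i → F^[n k] (E j) = i := fun k _ _ =>
    iterate_eq_int_of_eq_mul hF hE (hn k)
  refine ⟨strictMono_int_of_lt_succ fun k => ?_, fun k => ?_, hnper, fun k => ?_, fun k => ?_⟩
  · refine hinj.lt_iff_lt.1 ?_
    rw [hE, hE, hstep]
    push_cast
    have : (0 : ℝ) < 2 ^ (N - n k) := by positivity
    linarith
  · refine hinj.injective ?_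
    have := hF.iterate_add_int N (E (τ k)) 1
    push_cast at this
    rw [this, hE, hE, hper]
    push_cast
    ring
  · obtain ⟨i, hi⟩ := hdvd k
    exact ⟨i, hroot k hi⟩
  · obtain ⟨i, hi⟩ := hdvd k
    rw [hroot k hi, hroot k (i := i + 1) (by rw [hstep, hi]; ring)]
    push_cast; ring

/-- A subdivision whose first two pieces have degree `B` and the other ones are chosen so that
there are `2 ^ A` pieces in total. -/
theorem exists_of_two_pieces (hF : IsDegTwoLift F) {A B : ℕ} (hB : 2 ≤ B) (hBA : B ≤ A) (j : ℤ) :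
    ∃ q m, DyadicSubdivision F (2 ^ A) q m ∧ m 0 = B ∧ m 1 = B ∧
      F^[B] (q 0) = j ∧ F^[B] (q 1) = (j + 1 : ℤ) := by
  choose E hE using fun i : ℤ => hF.iterate_surjective (A + 1) i
  obtain ⟨R, hR⟩ : ∃ R : ℤ, R = 2 ^ A := ⟨_, rfl⟩
  obtain ⟨L, hL⟩ : ∃ L : ℤ, L = 2 ^ (A + 1 - B) := ⟨_, rfl⟩
  have hR0 : 0 < R := by rw [hR]; positivity
  have hL2 : 2 ∣ L := by rw [hL]; exact dvd_pow_self _ (by omega)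
  have hL0 : 0 < L := by rw [hL]; positivity
  have hLR : 2 * L ≤ R := by
    rw [hR, hL, ← pow_succ']
    exact pow_le_pow_right₀ (by norm_num) (by omega)
  have hRL : 2 * R = L * 2 ^ B := by
    rw [hR, hL, ← pow_add, ← pow_succ', Nat.sub_add_cancel (by omega)]
  set s : ℤ → ℤ := fun i => if i < 2 then i * L else if i < 2 * L - 2 then 2 * L + i - 2 else 2 * i
    with hs
  set d : ℤ → ℕ := fun i => if i < 2 then B else if i < 2 * L - 2 then A + 1 else A with hd
  have hgap : ∀ i, (2 : ℤ) ^ (A + 1 - d i) = if i < 2 then L else if i < 2 * L - 2 then 1 else 2 := by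
    intro i
    simp only [hd]
    split_ifs <;> simp [hL]
  have hper : ∀ k, (k + R) / R = k / R + 1 ∧ (k + R) % R = k % R := fun k =>
    ⟨Int.add_ediv_of_dvd_right (dvd_refl R) |>.trans (by rw [Int.ediv_self hR0.ne']),
      Int.add_emod_right k R⟩
  have hRcast : (((2 ^ A : ℕ) : ℤ)) = R := by rw [hR]; push_cast; rfl
  have hτ : DyadicSubdivision F (2 ^ A) (fun k => E (j * L + 2 * R * (k / R) + s (k % R)))
      (fun k => d (k % R)) := by
    refine of_int_sequence hF hE (fun k => ?_) (fun k => ?_) (fun k => ?_) (fun k => ?_)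
      fun k => ?_
    · simp only [hd]
      split_ifs <;> omega
    · rw [hgap]
      simp only [hs]
      split_ifs
      · rw [hRL]
        exact ⟨j + 2 ^ B * (k / R) + k % R, by ring⟩
      · exact one_dvd _
      · obtain ⟨c, hc⟩ := hL2
        exact ⟨j * c + R * (k / R) + k % R, by rw [hc]; ring⟩
    · rw [hgap]
      have h1 := Int.emod_nonneg k hR0.ne'
      have h2 := Int.emod_lt_of_pos k hR0
      have h3 := Int.emod_add_mul_ediv k R
      rcases lt_or_ge (k % R + 1) R with h4 | h4
      · obtain ⟨h5, h6⟩ := (Int.ediv_emod_unique (a := k + 1) (q := k / R) (r := k % R + 1) hR0).2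
          ⟨by linarith, by linarith, h4⟩
        rw [h5, h6]
        simp only [hs]
        generalize k % R = i at *
        obtain rfl | rfl | hi : i = 0 ∨ i = 1 ∨ 2 ≤ i := by omega
        · norm_num
        · norm_num
          have := Int.le_of_dvd hL0 hL2
          split_ifs <;> linarith
        · split_ifs <;> linarith
      · obtain ⟨h5, h6⟩ := (Int.ediv_emod_unique (a := k + 1) (q := k / R + 1) (r := 0) hR0).2
          ⟨by linarith, le_rfl, hR0⟩
        rw [h5, h6]
        have h7 : k % R = R - 1 := by omega
        simp only [hs, h7]
        rw [if_pos two_pos, if_neg (show ¬ R - 1 < 2 by omega),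
          if_neg (show ¬ R - 1 < 2 * L - 2 by omega), if_neg (show ¬ R - 1 < 2 by omega),
          if_neg (show ¬ R - 1 < 2 * L - 2 by omega)]
        ring
    · rw [hRcast, (hper k).1, (hper k).2, pow_succ, ← hR]
      ring
    · rw [hRcast, (hper k).2]
  have h0 : (0 : ℤ) / R = 0 ∧ (0 : ℤ) % R = 0 := by simp
  have h1 : (1 : ℤ) / R = 0 ∧ (1 : ℤ) % R = 1 :=
    (Int.ediv_emod_unique hR0).2 ⟨by ring, by norm_num, by omega⟩
  refine ⟨_, _, hτ, by simp [hd], by simp [hd, h1], ?_, ?_⟩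
  · refine iterate_eq_int_of_eq_mul hF hE (by omega) ?_
    rw [h0.1, h0.2, ← hL]
    simp [hs, mul_comm]
  · refine iterate_eq_int_of_eq_mul hF hE (by omega) ?_
    rw [h1.1, h1.2, ← hL]
    simp [hs]
    ring

end DyadicSubdivision

/-- The Thompson group realizes locally the germs `F^[b]⁻¹ ∘ (F^[a] + k)`. -/
theorem exists_inThompsonGroup_eventually_iterate_eq {φ : UnitAddCircle → UnitAddCircle}
    {F : ℝ → ℝ} (hφ : ∀ x : ℝ, φ x = (F x : ℝ)) (hF : IsDegTwoLift F) {a b : ℕ} (hab : b ≤ a)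
    (k : ℤ) (x : ℝ) : ∃ g G, InThompsonGroup φ F g ∧ IsOPLift g G ∧
      ∀ᶠ y in 𝓝 x, F^[b] (G y) = F^[a] y + k := by
  have hA := hF.iterate_strictMono (2 + a)
  choose E hE using fun i : ℤ => hF.iterate_surjective (2 + a) i
  set i : ℤ := ⌈F^[2 + a] x⌉ - 1 with hi
  have hi1 : (i : ℝ) < F^[2 + a] x := by
    rw [hi]; push_cast; linarith [Int.ceil_lt_add_one (F^[2 + a] x)]
  have hi2 : F^[2 + a] x < i + 2 := by
    rw [hi]; push_cast; linarith [Int.le_ceil (F^[2 + a] x)]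
  have hp : DyadicSubdivision F (2 ^ (2 + a)) (fun k => E (i + k)) (fun _ => 2 + a) :=
    DyadicSubdivision.of_int_sequence hF hE (fun _ => le_rfl) (fun _ => by simp)
      (fun _ => by simp; ring) (fun _ => by push_cast; ring) fun _ => rfl
  obtain ⟨q, m, hq, hm0, hm1, hq0, hq1⟩ :=
    DyadicSubdivision.exists_of_two_pieces hF (A := 2 + a) (B := 2 + b) (by omega) (by omega)
      (i + 2 ^ 2 * k)
  obtain ⟨g, G, hg, hG, h⟩ := hp.exists_inThompsonGroup hφ hF (by positivity) hq
  have h0 := h 0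
  have h1 := h 1
  simp only [hm0, hm1, hq0, hq1, hE] at h0 h1
  push_cast at h0 h1
  refine ⟨g, G, hg, hG, ?_⟩
  have hev : ∀ᶠ y in 𝓝 x, y ∈ Ioo (E (i + 0)) (E (i + 2)) :=
    Ioo_mem_nhds (hA.lt_iff_lt.1 (by rw [hE]; push_cast; linarith))
      (hA.lt_iff_lt.1 (by rw [hE]; push_cast; linarith))
  filter_upwards [hev] with y hy
  refine (hF.iterate_strictMono 2).injective ?_
  rw [hF.iterate_add_int, ← Function.iterate_add_apply, ← Function.iterate_add_apply]
  rcases le_total y (E (i + 1)) with h2 | h2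
  · linarith [h0 y ⟨hy.1.le, by simpa using h2⟩]
  · linarith [h1 y ⟨h2, hy.2.le⟩]

theorem IsDegTwoLift.hasDerivAt_of_eventually_iterate_eq {F G : ℝ → ℝ} (hF : IsDegTwoLift F)
    (hd : Differentiable ℝ F) (hpos : ∀ x, 0 < deriv F x) {a b : ℕ} {k x : ℝ}
    (h : ∀ᶠ y in 𝓝 x, F^[b] (G y) = F^[a] y + k) :
    HasDerivAt G ((orbitDeriv F b (G x))⁻¹ * orbitDeriv F a x) x := by
  set e := (hF.iterate_strictMono b).orderIsoOfSurjective _ (hF.iterate_surjective b) with he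
  have hGe : ∀ᶠ y in 𝓝 x, G y = e.symm (F^[a] y + k) := h.mono fun y hy => by
    rw [← hy]; exact (e.symm_apply_apply _).symm
  have h1 : HasDerivAt e (orbitDeriv F b (G x)) (e.symm (F^[a] x + k)) := by
    rw [← hGe.self_of_nhds]
    exact hasDerivAt_iterate_orbitDeriv hd b (G x)
  have h2 : HasDerivAt e.symm (orbitDeriv F b (G x))⁻¹ (F^[a] x + k) :=
    h1.of_local_left_inverse e.symm.continuous.continuousAt (orbitDeriv_pos hpos _ _).ne'
      (Eventually.of_forall e.apply_symm_apply)
  exact (h2.comp x ((hasDerivAt_iterate_orbitDeriv hd a x).add_const k)).congr_of_eventuallyEq hGe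

theorem one_le_of_hasDerivAt_of_lt {G : ℝ → ℝ} {d x : ℝ} (hG : HasDerivAt G d x) (hx : G x = x)
    (h : ∀ᶠ y in 𝓝[>] x, y < G y) : 1 ≤ d := by
  have ht : Tendsto (slope G x) (𝓝[>] x) (𝓝 d) := (hasDerivAt_iff_tendsto_slope.1 hG).mono_left <|
    nhdsWithin_mono x fun y (hy : x < y) => hy.ne'
  refine ge_of_tendsto ht ?_
  filter_upwards [h, self_mem_nhdsWithin] with y hy hxy
  have : 0 < y - x := sub_pos.2 hxy
  rw [slope_def_field, hx, le_div_iff₀ this]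
  linarith

/-- Translating a lift by an integer does not change the Thompson group. -/
theorem InThompsonGroup.of_sub_int {φ g : UnitAddCircle → UnitAddCircle} {F F₀ : ℝ → ℝ} {c : ℤ}
    (hF₀ : IsDegTwoLift F₀) (hc : ∀ y, F y = F₀ y + c) (h : InThompsonGroup φ F₀ g) :
    InThompsonGroup φ F g := by
  have hit : ∀ n : ℕ, ∃ i : ℤ, ∀ y, F^[n] y = F₀^[n] y + i := by
    intro n
    induction n with
    | zero => exact ⟨0, by simp⟩
    | succ n ih =>
      obtain ⟨i, hi⟩ := ih
      refine ⟨2 * i + c, fun y => ?_⟩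
      rw [Function.iterate_succ_apply', hi, hc, hF₀.map_add_int, Function.iterate_succ_apply']
      push_cast
      ring
  have hdy : ∀ {n I}, IsDyadic F₀ n I → IsDyadic F n I := by
    rintro n I ⟨a, b, hab, ⟨k, hk⟩, hb, hI⟩
    obtain ⟨i, hi⟩ := hit n
    exact ⟨a, b, hab, ⟨k + i, by rw [hi, hk]; push_cast; ring⟩, by rw [hi, hi, hb]; ring, hI⟩
  obtain ⟨hG, r, I, J, n, m, hr, hI, hJ, h⟩ := h
  exact ⟨hG, r, I, J, n, m, hr, fun k => hdy (hI k), fun k => hdy (hJ k), h⟩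

/-- A nonexpandable point of the exceptional set is a topologically repelling parabolic fixed point
of some element of the Thompson group. -/
theorem exists_parabolic_repelling {φ : UnitAddCircle → UnitAddCircle} {F : ℝ → ℝ}
    (hφ : ∀ x : ℝ, φ x = (F x : ℝ)) (hF : IsDegTwoLift F) (hC2 : ContDiff ℝ 2 F)
    (hpos : ∀ x, 0 < deriv F x) (hne : {I | IsMaxPeriodicInterval φ I}.Nonempty) {x : ℝ}
    (hxΛ : (x : UnitAddCircle) ∈ lambdaSet φ) (hx : NonExpandable φ F x) :
    ∃ g G, InThompsonGroup φ F g ∧ IsOPLift g G ∧ G x = x ∧ deriv G x = 1 ∧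
      ∃ δ > 0, (∀ y, x < y → y < x + δ → y < G y) ∧ ∀ y, x - δ < y → y < x → G y < y := by
  obtain ⟨H, hH⟩ := hF.exists_isDoublingFactor
  obtain ⟨p, hp, hpfib⟩ := exists_periodic_fiber_of_nonempty hφ hF hH hne
  have hd : Differentiable ℝ F := hC2.differentiable (by norm_num)
  by_cases hper : ∀ n : ℕ, ¬ DoublingPeriodic (2 ^ n * H x)
  · obtain ⟨n, hn⟩ := exists_one_lt_orbitDeriv_of_not_preperiodic hC2 hpos hF hH hp hpfib hper
    obtain ⟨g, G, hg, hG, h⟩ :=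
      exists_inThompsonGroup_eventually_iterate_eq hφ hF (Nat.zero_le n) 0 x
    have h1 := (hF.hasDerivAt_of_eventually_iterate_eq hd hpos h).deriv
    have h2 := hx g G hg hG x rfl
    simp [h1, orbitDeriv] at h2 hn
    linarith
  push Not at hper
  obtain ⟨q, hq⟩ := hper
  obtain ⟨s, hs, k, hk⟩ := id hq
  rw [← hH.map_iterate] at hq
  have hfib : ∀ y, H y = H (F^[q] x) → y = F^[q] x := fun y hy =>
    eq_of_mem_lambdaSet_of_periodic hφ hF hH hxΛ hq hy
  obtain ⟨g, G, hg, hG, h⟩ :=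
    exists_inThompsonGroup_eventually_iterate_eq hφ hF (Nat.le_add_right q s) (-k) x
  have hqm := hF.iterate_strictMono q
  have hGx : G x = x := by
    refine hqm.injective (hfib _ ?_)
    rw [h.self_of_nhds, hH.map_add_int, hH.map_iterate, hH.map_iterate, pow_add]
    push_cast
    linarith
  have hHG : ∀ᶠ y in 𝓝 x, 2 ^ q * H (G y) = 2 ^ s * (2 ^ q * H y) - k := h.mono fun y hy => by
    rw [← hH.map_iterate, hy, hH.map_add_int, hH.map_iterate, pow_add]
    push_cast
    ring
  have hs1 : (1 : ℝ) < 2 ^ s := one_lt_pow₀ one_lt_two (by omega)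
  have hinj : ∀ y, H y = H x → y = x := fun y hy => hqm.injective
    (hfib _ (by rw [hH.map_iterate, hH.map_iterate, hy]))
  have hq0 : (0 : ℝ) < 2 ^ q := by positivity
  obtain ⟨δ, hδ, hball⟩ := Metric.eventually_nhds_iff.1 hHG
  have hright : ∀ y, x < y → y < x + δ → y < G y := by
    intro y hxy hyδ
    by_contra! hle
    have h1 := mul_le_mul_of_nonneg_left (hH.monotone hle) hq0.le
    rw [hball (by rw [Real.dist_eq, abs_of_pos] <;> linarith)] at h1
    have h2 := mul_le_mul_of_nonneg_left (hH.monotone hxy.le) hq0.le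
    refine hxy.ne' (hinj y (mul_left_cancel₀ hq0.ne' (le_antisymm ?_ h2)))
    by_contra! hlt
    nlinarith
  have hleft : ∀ y, x - δ < y → y < x → G y < y := by
    intro y hyδ hxy
    by_contra! hle
    have h1 := mul_le_mul_of_nonneg_left (hH.monotone hle) hq0.le
    rw [hball (by rw [Real.dist_eq, abs_of_neg] <;> linarith)] at h1
    have h2 := mul_le_mul_of_nonneg_left (hH.monotone hxy.le) hq0.le
    refine hxy.ne (hinj y (mul_left_cancel₀ hq0.ne' (le_antisymm h2 ?_)))
    by_contra! hlt
    nlinarith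
  have hder := hF.hasDerivAt_of_eventually_iterate_eq hd hpos h
  refine ⟨g, G, hg, hG, hGx, le_antisymm (hx g G hg hG x rfl) ?_, δ, hδ, hright, hleft⟩
  rw [hder.deriv]
  refine one_le_of_hasDerivAt_of_lt hder hGx ?_
  filter_upwards [Ioo_mem_nhdsGT (show x < x + δ by linarith)] with y hy
  exact hright y hy.1 hy.2

/-- every `C²` action of `T_φ` admitting the exceptional minimal set `Λ`
satisfies property (Λ∗). -/
theorem thompson_exceptional_property_lambda_star
    (φ : UnitAddCircle → UnitAddCircle) (F : ℝ → ℝ)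
    (hF : IsLiftDeg2 φ F) (hC2 : ContDiff ℝ 2 F) (hpos : ∀ x : ℝ, 0 < deriv F x)
    (h0 : φ 0 = 0) (hd1 : deriv F 0 = 1) (hd2 : deriv (deriv F) 0 = 0)
    (hnc : ¬ ConjugateToDoubling φ)
    (hfin : {I | IsMaxPeriodicInterval φ I}.Finite)
    (hne : {I | IsMaxPeriodicInterval φ I}.Nonempty)
    (x : UnitAddCircle) (hxΛ : x ∈ lambdaSet φ) (hx : NonExpandable φ F x) :
    ((∀ ε : ℝ, 0 < ε → (rightArc x ε ∩ lambdaSet φ).Nonempty) →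
      ∃ (g : UnitAddCircle → UnitAddCircle) (G : ℝ → ℝ) (x' δ : ℝ),
        InThompsonGroup φ F g ∧ IsOPLift g G ∧ (x' : UnitAddCircle) = x ∧
        g x = x ∧ G x' = x' ∧ deriv G x' = 1 ∧ 0 < δ ∧
        ∀ y : ℝ, x' < y → y < x' + δ → y < G y) ∧
    ((∀ ε : ℝ, 0 < ε → (leftArc x ε ∩ lambdaSet φ).Nonempty) →
      ∃ (g : UnitAddCircle → UnitAddCircle) (G : ℝ → ℝ) (x' δ : ℝ),
        InThompsonGroup φ F g ∧ IsOPLift g G ∧ (x' : UnitAddCircle) = x ∧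
        g x = x ∧ G x' = x' ∧ deriv G x' = 1 ∧ 0 < δ ∧
        ∀ y : ℝ, x' - δ < y → y < x' → G y < y) := by
  obtain ⟨x, rfl⟩ := QuotientAddGroup.mk_surjective x
  obtain ⟨hFc, hFm, hF1, hφ⟩ := hF
  obtain ⟨c, hc⟩ : ∃ c : ℤ, F 0 = c := by
    have h := hφ 0
    rw [AddCircle.coe_zero, h0, ← AddCircle.coe_zero] at h
    obtain ⟨m, hm⟩ := unitAddCircle_coe_eq_coe_iff.1 h.symm
    exact ⟨m, by simpa using hm⟩
  have hF₀ : IsDegTwoLift (fun y => F y - c) :=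
    ⟨hFc.sub continuous_const, fun _ _ h => sub_lt_sub_right (hFm h) _,
      fun y => by rw [hF1]; ring, by rw [hc, sub_self]⟩
  have hφ₀ : ∀ y : ℝ, φ y = ((F y - c : ℝ) : UnitAddCircle) := fun y => by
    rw [hφ]
    exact unitAddCircle_coe_eq_coe_iff.2 ⟨c, by ring⟩
  have hT : ∀ {g}, InThompsonGroup φ (fun y => F y - c) g → InThompsonGroup φ F g :=
    fun h => h.of_sub_int hF₀ (c := c) fun y => by ring
  obtain ⟨g, G, hg, hG, hGx, hGd, δ, hδ, h1, h2⟩ := exists_parabolic_repelling hφ₀ hF₀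
    (hC2.sub contDiff_const) (fun y => by simpa using hpos y) hne hxΛ
    fun g G hg => hx g G (hT hg)
  have hgx : g (x : UnitAddCircle) = x := by rw [hG.2.2.2, hGx]
  exact ⟨fun _ => ⟨g, G, x, δ, hT hg, hG, rfl, hgx, hGx, hGd, hδ, h1⟩,
    fun _ => ⟨g, G, x, δ, hT hg, hG, rfl, hgx, hGx, hGd, hδ, h2⟩⟩
end
end

section
/- Let φ be a circle covering map of degree two, not topologically conjugate to the doubling map, such that the collection of all maximal periodic intervals of φ is finite and nonempty, say I₁,…,I_r, and set Λ := 𝕊¹ \ ⋃_{n≥0} φ^{-n}(I₁ ∪ ⋯ ∪ I_r). Let x be a periodic point of φ of period s. If (x, x+ε) ∩ Λ ≠ ∅ for every ε > 0, then φ^s is repelling in some right neighborhood of x: there exists δ > 0 such that, denoting by f the lift of φ^s fixing a lift x̃ of x, one has f(y) > y for all y ∈ (x̃, x̃+δ). Symmetrically, if (x−ε, x) ∩ Λ ≠ ∅ for every ε > 0, then there exists δ > 0 with f(y) < y for all y ∈ (x̃−δ, x̃). -/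
open Set Filter MeasureTheory Topology

noncomputable section

theorem UnitAddCircle.coe_eq_coe_iff_exists_int {x y : ℝ} :
    (x : UnitAddCircle) = (y : UnitAddCircle) ↔ ∃ n : ℤ, y = x + n := by
  rw [QuotientAddGroup.eq, AddSubgroup.mem_zmultiples_iff]
  refine exists_congr fun n => ?_
  simp only [zsmul_eq_mul, mul_one]
  constructor <;> intro h <;> linarith

namespace IsLiftDeg2

variable {φ : UnitAddCircle → UnitAddCircle} {F : ℝ → ℝ}

theorem strictMono_iterate (hF : IsLiftDeg2 φ F) (n : ℕ) : StrictMono F^[n] :=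
  hF.2.1.iterate n

theorem map_add_int (hF : IsLiftDeg2 φ F) (x : ℝ) (m : ℤ) : F (x + m) = F x + 2 * m := by
  induction m using Int.induction_on with
  | zero => simp
  | succ i ih =>
    have := hF.2.2.1 (x + (i : ℤ))
    push_cast at *
    rw [← add_assoc, this, ih]; ring
  | pred i ih =>
    have := hF.2.2.1 (x + ((-(i : ℤ) - 1 : ℤ) : ℝ))
    push_cast at *
    rw [show x + (-(i : ℝ) - 1) + 1 = x + -(i : ℝ) by ring, ih] at this
    linarith

theorem iterate_add_int (hF : IsLiftDeg2 φ F) (n : ℕ) (x : ℝ) (m : ℤ) :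
    F^[n] (x + m) = F^[n] x + 2 ^ n * m := by
  induction n generalizing x m with
  | zero => simp
  | succ n ih =>
    rw [Function.iterate_succ_apply, Function.iterate_succ_apply, hF.map_add_int]
    have := ih (F x) (2 * m)
    push_cast at this
    rw [this]; ring

theorem coe_iterate (hF : IsLiftDeg2 φ F) (n : ℕ) (x : ℝ) :
    φ^[n] (x : UnitAddCircle) = ((F^[n] x : ℝ) : UnitAddCircle) := by
  induction n generalizing x with
  | zero => rfl
  | succ n ih => rw [Function.iterate_succ_apply, Function.iterate_succ_apply, hF.2.2.2, ih]

theorem surjective (hF : IsLiftDeg2 φ F) : Function.Surjective F := by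
  intro T
  refine mem_range_of_exists_le_of_exists_ge hF.1
    ⟨0 + (⌊(T - F 0) / 2⌋ : ℤ), ?_⟩ ⟨0 + (⌈(T - F 0) / 2⌉ : ℤ), ?_⟩
  · rw [hF.map_add_int]
    linarith [Int.floor_le ((T - F 0) / 2)]
  · rw [hF.map_add_int]
    linarith [Int.le_ceil ((T - F 0) / 2)]

theorem iterate_add_two_pow_le (hF : IsLiftDeg2 φ F) {x y : ℝ} (h : x + 1 ≤ y) (n : ℕ) :
    F^[n] x + 2 ^ n ≤ F^[n] y := by
  have h₁ := hF.iterate_add_int n x 1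
  have h₂ := (hF.strictMono_iterate n).monotone h
  push_cast at h₁
  linarith

theorem iterate_lt_add_one_of_le (hF : IsLiftDeg2 φ F) {x y : ℝ} {n m : ℕ} (hnm : n ≤ m)
    (h : F^[m] y < F^[m] x + 1) : F^[n] y < F^[n] x + 1 := by
  by_contra! hc
  have h₁ := hF.iterate_add_two_pow_le hc (m - n)
  rw [← Function.iterate_add_apply, ← Function.iterate_add_apply, Nat.sub_add_cancel hnm] at h₁
  have h₂ : (1 : ℝ) ≤ 2 ^ (m - n) := one_le_pow₀ (by norm_num)
  linarith

/-- If some iterate of `F` maps `[c, d]` into an integer translate of itself and `[c, d]` has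
length less than one, then all iterates of `[c, d]` have length less than one. -/
theorem iterate_lt_add_one (hF : IsLiftDeg2 φ F) {c d : ℝ} {t : ℕ} {k : ℤ} (ht : 1 ≤ t)
    (hcd : c ≤ d) (hd : d < c + 1)
    (hmaps : ∀ y ∈ Icc c d, F^[t] y ∈ Icc (c + k) (d + k)) (n : ℕ) :
    F^[n] d < F^[n] c + 1 := by
  have key : ∀ m : ℕ, ∃ j : ℤ, ∀ y ∈ Icc c d, F^[t * m] y ∈ Icc (c + j) (d + j) := by
    intro m
    induction m with
    | zero => exact ⟨0, by simp⟩
    | succ m ih =>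
      obtain ⟨j, hj⟩ := ih
      refine ⟨k + 2 ^ t * j, fun y hy => ?_⟩
      obtain ⟨h₁, h₂⟩ := hj y hy
      have h₃ := hmaps (F^[t * m] y + ((-j : ℤ) : ℝ))
        ⟨by push_cast; linarith, by push_cast; linarith⟩
      rw [hF.iterate_add_int, ← Function.iterate_add_apply,
        show t + t * m = t * (m + 1) by ring] at h₃
      push_cast at h₃ ⊢
      exact ⟨by linarith [h₃.1], by linarith [h₃.2]⟩
  obtain ⟨j, hj⟩ := key n
  refine hF.iterate_lt_add_one_of_le (Nat.le_mul_of_pos_left n ht) ?_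
  linarith [(hj c (left_mem_Icc.2 hcd)).1, (hj d (right_mem_Icc.2 hcd)).2]

/-- The lift of a self-map of a proper closed arc maps the lifted interval into an integer
translate of itself. -/
theorem exists_int_mapsTo_Icc (hF : IsLiftDeg2 φ F) {c ℓ : ℝ} {t : ℕ} (hℓ : 0 < ℓ)
    (hℓ₁ : ℓ < 1) (h : MapsTo φ^[t] (closedArc c ℓ) (closedArc c ℓ)) :
    ∃ k : ℤ, ∀ y ∈ Icc c (c + ℓ), F^[t] y ∈ Icc (c + k) (c + ℓ + k) := by
  have hlift : ∀ y ∈ Icc c (c + ℓ), ∃ k : ℤ, F^[t] y ∈ Icc (c + k) (c + ℓ + k) := by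
    intro y hy
    obtain ⟨u, hu, huy⟩ := h (mem_image_of_mem _ hy)
    rw [hF.coe_iterate] at huy
    obtain ⟨k, hk⟩ := UnitAddCircle.coe_eq_coe_iff_exists_int.1 huy
    exact ⟨k, by rw [hk]; exact ⟨by linarith [hu.1], by linarith [hu.2]⟩⟩
  obtain ⟨k, hk⟩ := hlift c ⟨le_rfl, by linarith⟩
  refine ⟨k, fun y hy => ⟨hk.1.trans ((hF.strictMono_iterate t).monotone hy.1), ?_⟩⟩
  by_contra! hgt
  obtain ⟨v, hv₁, hv₂⟩ : ∃ v, c + ℓ + k < v ∧ v < min (F^[t] y) (c + k + 1) :=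
    exists_between (lt_min hgt (by linarith))
  obtain ⟨w, hw, rfl⟩ := intermediate_value_Icc hy.1 (hF.1.iterate t).continuousOn
    ⟨hk.2.trans hv₁.le, (hv₂.trans_le (min_le_left _ _)).le⟩
  obtain ⟨j, hj⟩ := hlift w ⟨hw.1, hw.2.trans hy.2⟩
  have h₁ : (k : ℝ) < j := by linarith [hj.2]
  have h₂ : (j : ℝ) < k + 1 := by linarith [hj.1, hv₂.trans_le (min_le_right _ _)]
  norm_cast at h₁ h₂
  lia

/-- The set of points whose orbits under the lift `F` stay at distance at most one from the
orbit of `a`. -/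
def shadowSet (F : ℝ → ℝ) (a : ℝ) : Set ℝ := {y | ∀ n : ℕ, |F^[n] y - F^[n] a| ≤ 1}

theorem mem_shadowSet_of_mem_Icc (hF : IsLiftDeg2 φ F) {a c d y : ℝ}
    (h : ∀ n, F^[n] d < F^[n] c + 1) (ha : a ∈ Icc c d) (hy : y ∈ Icc c d) :
    y ∈ shadowSet F a := by
  intro n
  have hm := (hF.strictMono_iterate n).monotone
  rw [abs_le]
  constructor <;> linarith [h n, hm ha.1, hm ha.2, hm hy.1, hm hy.2]

theorem exists_shadowSet_eq_Icc (hF : IsLiftDeg2 φ F) (a : ℝ) :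
    ∃ α ℓ : ℝ, 0 ≤ ℓ ∧ ℓ < 1 ∧ shadowSet F a = Icc α (α + ℓ) := by
  have hcl : IsClosed (shadowSet F a) := by
    simp only [shadowSet, ofPred_forall]
    exact isClosed_iInter fun n => isClosed_le
      (((hF.1.iterate n).sub continuous_const).abs) continuous_const
  have hbdd : shadowSet F a ⊆ Icc (a - 1) (a + 1) := fun y hy => by
    have := abs_le.1 (hy 0)
    simp only [Function.iterate_zero, id] at this
    exact ⟨by linarith [this.1], by linarith [this.2]⟩
  have hcomp : IsCompact (shadowSet F a) := isCompact_Icc.of_isClosed_subset hcl hbdd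
  have hne : (shadowSet F a).Nonempty := ⟨a, fun n => by simp⟩
  have hord : OrdConnected (shadowSet F a) := ⟨fun u hu v hv w hw n => by
    have hm := (hF.strictMono_iterate n).monotone
    have h₁ := abs_le.1 (hu n)
    have h₂ := abs_le.1 (hv n)
    rw [abs_le]
    constructor <;> linarith [hm hw.1, hm hw.2, h₁.1, h₂.2]⟩
  have heq := eq_Icc_of_connected_compact ⟨hne, hord.isPreconnected⟩ hcomp
  set α := sInf (shadowSet F a)
  set β := sSup (shadowSet F a)
  have hle : α ≤ β := nonempty_Icc.1 (heq ▸ hne)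
  refine ⟨α, β - α, sub_nonneg.2 hle, ?_, by rw [add_sub_cancel, heq]⟩
  by_contra! hc
  have h₁ := hF.iterate_add_two_pow_le (show α + 1 ≤ β by linarith) 2
  have hα : α ∈ shadowSet F a := hcomp.sInf_mem hne
  have hβ : β ∈ shadowSet F a := hcomp.sSup_mem hne
  linarith [(abs_le.1 (hα 2)).1, (abs_le.1 (hβ 2)).2]

theorem mem_shadowSet_iff_iterate (hF : IsLiftDeg2 φ F) {a y : ℝ} {s : ℕ} {k : ℤ}
    (ha : F^[s] a = a + k) : F^[s] y - k ∈ shadowSet F a ↔ y ∈ shadowSet F a := by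
  have hshift : ∀ n, F^[n] (F^[s] y - k) - F^[n] a = F^[n + s] y - F^[n + s] a := by
    intro n
    have h₁ := hF.iterate_add_int n (F^[s] y) (-k)
    have h₂ := hF.iterate_add_int n a k
    rw [← ha, ← Function.iterate_add_apply] at h₂
    rw [← Function.iterate_add_apply] at h₁
    push_cast at h₁
    rw [sub_eq_add_neg (F^[s] y), h₁, h₂]
    ring
  constructor
  · intro h n
    have h₁ := abs_le.1 (hshift (n + 1) ▸ h (n + 1))
    have hn : n + 1 + s = s + 1 + n := by ring
    rw [hn, Function.iterate_add_apply F (s + 1), Function.iterate_add_apply F (s + 1)] at h₁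
    have hpow : (1 : ℝ) < 2 ^ (s + 1) := one_lt_pow₀ (by norm_num) (by simp)
    rw [abs_le]
    constructor <;> by_contra! hc
    · linarith [hF.iterate_add_two_pow_le (show F^[n] y + 1 ≤ F^[n] a by linarith) (s + 1)]
    · linarith [hF.iterate_add_two_pow_le (show F^[n] a + 1 ≤ F^[n] y by linarith) (s + 1)]
  · intro h n
    rw [hshift]
    exact h (n + s)

/-- Two distinct points at distance less than one that are translated by the same integer under
an iterate of the lift span an arc contained in a maximal periodic interval. -/
theorem exists_isMaxPeriodicInterval (hF : IsLiftDeg2 φ F) {a b p : ℝ} {s : ℕ} {k : ℤ}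
    (hs : 1 ≤ s) (hab : a < b) (hb : b < a + 1) (hFa : F^[s] a = a + k)
    (hFb : F^[s] b = b + k) (hp : p ∈ Icc a b) :
    ∃ I, IsMaxPeriodicInterval φ I ∧ (p : UnitAddCircle) ∈ I := by
  obtain ⟨α, ℓ, -, hℓ₁, hJ⟩ := hF.exists_shadowSet_eq_Icc a
  have hspan : Icc a b ⊆ shadowSet F a := fun y hy =>
    hF.mem_shadowSet_of_mem_Icc (hF.iterate_lt_add_one hs hab.le hb (k := k) fun u hu => by
      rw [← hFa, ← hFb]
      exact ⟨(hF.strictMono_iterate s).monotone hu.1, (hF.strictMono_iterate s).monotone hu.2⟩)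
      (left_mem_Icc.2 hab.le) hy
  have ha := hspan (left_mem_Icc.2 hab.le)
  have hℓ : 0 < ℓ := by
    have hb' := hspan (right_mem_Icc.2 hab.le)
    rw [hJ] at ha hb'
    linarith [ha.1, hb'.2]
  have harc : closedArc α ℓ = (fun t : ℝ => (t : UnitAddCircle)) '' shadowSet F a := by
    rw [hJ]; rfl
  have hcoe : ∀ y : ℝ, φ^[s] (y : UnitAddCircle) = ((F^[s] y - k : ℝ) : UnitAddCircle) := fun y => by
    rw [hF.coe_iterate, UnitAddCircle.coe_eq_coe_iff_exists_int]
    exact ⟨-k, by push_cast; ring⟩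
  have hinv : ∀ {y}, F^[s] y - k ∈ shadowSet F a ↔ y ∈ shadowSet F a :=
    hF.mem_shadowSet_iff_iterate hFa
  refine ⟨closedArc α ℓ, ⟨⟨s, hs, ⟨α, ℓ, hℓ, hℓ₁, rfl⟩, ?_, ?_, ?_⟩, ?_⟩, ?_⟩
  · rw [harc]
    rintro _ ⟨y, hy, rfl⟩
    exact ⟨_, hinv.2 hy, (hcoe y).symm⟩
  · rw [harc]
    rintro _ ⟨y, hy, rfl⟩ _ ⟨w, hw, rfl⟩ h
    simp only [hcoe] at h
    obtain ⟨m, hm⟩ := UnitAddCircle.coe_eq_coe_iff_exists_int.1 h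
    rw [← hinv, hJ] at hy hw
    have h₁ : (m : ℝ) < 1 := by linarith [hy.1, hw.2]
    have h₂ : (-1 : ℝ) < m := by linarith [hy.2, hw.1]
    norm_cast at h₁ h₂
    obtain rfl : m = 0 := by lia
    have : y = w := (hF.strictMono_iterate s).injective (by push_cast at hm; linarith)
    rw [this]
  · rw [harc]
    rintro _ ⟨y, hy, rfl⟩
    obtain ⟨w, hw⟩ := hF.surjective.iterate s (y + k)
    have hwy : F^[s] w - k = y := by rw [hw]; ring
    refine ⟨w, ⟨w, hinv.1 (hwy ▸ hy), rfl⟩, ?_⟩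
    rw [hcoe, hwy]
  · rintro _ ⟨t, ht, ⟨c, ℓ', hℓ', hℓ₁', rfl⟩, hbij⟩ hsub
    refine hsub.antisymm ?_
    obtain ⟨j, hj⟩ := hF.exists_int_mapsTo_Icc hℓ' hℓ₁' hbij.mapsTo
    have hshort := hF.iterate_lt_add_one ht (by linarith) (by linarith) hj
    obtain ⟨u, hu, hua⟩ := hsub (harc ▸ mem_image_of_mem _ ha)
    obtain ⟨m, hm⟩ := UnitAddCircle.coe_eq_coe_iff_exists_int.1 hua
    rw [harc]
    rintro _ ⟨y, hy, rfl⟩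
    refine ⟨y + m, fun n => ?_, (UnitAddCircle.coe_eq_coe_iff_exists_int.2 ⟨m, rfl⟩).symm⟩
    have := hF.mem_shadowSet_of_mem_Icc hshort hu hy n
    rw [hm, hF.iterate_add_int, hF.iterate_add_int]
    simpa using this
  · rw [harc]
    exact mem_image_of_mem _ (hspan hp)

end IsLiftDeg2

/-- Lemma 2.2(b): if `Λ` accumulates on a periodic point `x` from one
side, then `φ^s` is repelling in a one-sided neighborhood of `x`; the repelling
condition is expressed via the lift of `φ^s` fixing the lift `x'` of `x`,
namely `y ↦ F^[s] y - (F^[s] x' - x')`. -/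
theorem periodic_point_accumulated_repelling
    (φ : UnitAddCircle → UnitAddCircle) (F : ℝ → ℝ)
    (hF : IsLiftDeg2 φ F)
    (hnc : ¬ ConjugateToDoubling φ)
    (hfin : {I | IsMaxPeriodicInterval φ I}.Finite)
    (hne : {I | IsMaxPeriodicInterval φ I}.Nonempty)
    (x : UnitAddCircle) (s : ℕ) (hs : 1 ≤ s) (hper : φ^[s] x = x)
    (x' : ℝ) (hx' : (x' : UnitAddCircle) = x) :
    ((∀ ε : ℝ, 0 < ε → (rightArc x ε ∩ lambdaSet φ).Nonempty) →
      ∃ δ : ℝ, 0 < δ ∧ ∀ y : ℝ, x' < y → y < x' + δ →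
        y < F^[s] y - (F^[s] x' - x')) ∧
    ((∀ ε : ℝ, 0 < ε → (leftArc x ε ∩ lambdaSet φ).Nonempty) →
      ∃ δ : ℝ, 0 < δ ∧ ∀ y : ℝ, x' - δ < y → y < x' →
        F^[s] y - (F^[s] x' - x') < y) := by
  obtain ⟨k, hk⟩ : ∃ k : ℤ, F^[s] x' = x' + k := by
    rw [← hx', hF.coe_iterate] at hper
    exact UnitAddCircle.coe_eq_coe_iff_exists_int.1 hper.symm
  have hpow : (2 : ℝ) ≤ 2 ^ s := by
    simpa using pow_le_pow_right₀ (one_le_two : (1 : ℝ) ≤ 2) hs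
  have hcont : Continuous fun y => F^[s] y - y := (hF.1.iterate s).sub continuous_id
  have hnot : ∀ {a b p : ℝ}, a < b → b < a + 1 → F^[s] a = a + k → F^[s] b = b + k →
      p ∈ Icc a b → (p : UnitAddCircle) ∉ lambdaSet φ := by
    intro a b p hab hb hFa hFb hp hΛ
    obtain ⟨I, hI, hpI⟩ := hF.exists_isMaxPeriodicInterval hs hab hb hFa hFb hp
    exact hΛ.2 (mem_iUnion.2 ⟨0, mem_iUnion₂.2 ⟨I, hI, hpI⟩⟩)
  constructor
  · intro hacc
    refine ⟨1, one_pos, fun y hy₁ hy₂ => ?_⟩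
    by_contra! hc
    have hend := hF.iterate_add_int s x' 1
    push_cast at hend
    obtain ⟨z, hz, hFz⟩ : (k : ℝ) ∈ (fun y => F^[s] y - y) '' Icc y (x' + 1) :=
      intermediate_value_Icc hy₂.le hcont.continuousOn ⟨by linarith, by linarith⟩
    have hz₁ : z < x' + 1 := lt_of_le_of_ne hz.2 (by
      rintro rfl
      simp only at hFz
      linarith)
    obtain ⟨_, ⟨t, ht₀, ht, rfl⟩, hΛ⟩ := hacc (z - x') (by linarith [hz.1])
    rw [← hx', ← AddCircle.coe_add] at hΛ
    exact hnot (by linarith [hz.1]) hz₁ hk (by simp only at hFz; linarith)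
      ⟨by linarith, by linarith⟩ hΛ
  · intro hacc
    refine ⟨1, one_pos, fun y hy₁ hy₂ => ?_⟩
    by_contra! hc
    have hend := hF.iterate_add_int s x' (-1)
    push_cast at hend
    rw [← sub_eq_add_neg] at hend
    obtain ⟨z, hz, hFz⟩ : (k : ℝ) ∈ (fun y => F^[s] y - y) '' Icc (x' - 1) y :=
      intermediate_value_Icc hy₁.le hcont.continuousOn ⟨by linarith, by linarith⟩
    have hz₁ : x' - 1 < z := lt_of_le_of_ne hz.1 (by
      rintro rfl
      simp only at hFz
      linarith)
    obtain ⟨_, ⟨t, ht₀, ht, rfl⟩, hΛ⟩ := hacc (x' - z) (by linarith [hz.2])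
    rw [← hx', ← AddCircle.coe_sub] at hΛ
    exact hnot (a := z) (by linarith [hz.2]) (by linarith) (by simp only at hFz; linarith) hk
      ⟨by linarith, by linarith⟩ hΛ
end
end
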